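/- Assume char(K) ∉ {2,3} and the residue field k has characteristic ∉ {2,3}. Let q ∈ K with 0 < |q| < 1, let m ≥ 2 be an integer, and suppose ψ_m ∈ K(z) is a rational map of degree m² satisfying ψ_m(x(w)) = x(w^m) for all w ∈ K^× with w ∉ q^ℤ and w^m ∉ q^ℤ, where x is Tate's series for the parameter q. Then the minimal resultant of ψ_m is given by: R_{[ψ_m]} = (m²(m²−1)/24) · ord(q) if m is odd, and R_{[ψ_m]} = ( m²(m²−1)/6 − (m⁵+m⁴−2m³)/(8(m+1)) ) · ord(q) if m is even. -/

import Mathlib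

open MvPolynomial Matrix

noncomputable section

variable {R : Type*} [CommRing R]

def coeffVec (e : ℕ) (F : MvPolynomial (Fin 2) R) (i : Fin (e + 1)) : R :=
  MvPolynomial.coeff (Finsupp.single 0 (e - (i : ℕ)) + Finsupp.single 1 (i : ℕ)) F

def sylv (e : ℕ) (a b : Fin (e + 1) → R) : Matrix (Fin (e + e)) (Fin (e + e)) R :=
  Matrix.of fun i j =>
    if h : (i : ℕ) < e then
      if hj : (i : ℕ) ≤ (j : ℕ) ∧ (j : ℕ) ≤ (i : ℕ) + e then
        a ⟨(j : ℕ) - (i : ℕ), by omega⟩ else 0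
    else
      if hj : (i : ℕ) - e ≤ (j : ℕ) ∧ (j : ℕ) ≤ (i : ℕ) then
        b ⟨(j : ℕ) - ((i : ℕ) - e), by omega⟩ else 0

def bres (e : ℕ) (F G : MvPolynomial (Fin 2) R) : R :=
  (sylv e (coeffVec e F) (coeffVec e G)).det

def comp2 (F f g : MvPolynomial (Fin 2) R) : MvPolynomial (Fin 2) R :=
  MvPolynomial.aeval ![f, g] F

def pairIter (F G : MvPolynomial (Fin 2) R) : ℕ → MvPolynomial (Fin 2) R × MvPolynomial (Fin 2) R
  | 0 => (X 0, X 1)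
  | n + 1 => (comp2 F (pairIter F G n).1 (pairIter F G n).2,
              comp2 G (pairIter F G n).1 (pairIter F G n).2)

variable (K : Type) [NontriviallyNormedField K] [IsUltrametricDist K]

def ordv (x : K) : ℝ := -Real.log ‖x‖

def intRing : Subring K where
  carrier := {x : K | ‖x‖ ≤ 1}
  one_mem' := by simp
  zero_mem' := by simp
  mul_mem' := by
    intro a b ha hb
    simp only [Set.mem_setOf_eq] at *
    calc ‖a * b‖ = ‖a‖ * ‖b‖ := norm_mul a b
    _ ≤ 1 * 1 := by gcongr
    _ = 1 := by ring
  add_mem' := by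
    intro a b ha hb
    simp only [Set.mem_setOf_eq] at *
    exact (IsUltrametricDist.norm_add_le_max a b).trans (max_le ha hb)
  neg_mem' := by
    intro a ha
    simp only [Set.mem_setOf_eq, norm_neg] at *
    exact ha

def maxIdl : Ideal (intRing K) where
  carrier := {x | ‖(x : K)‖ < 1}
  zero_mem' := by simp
  add_mem' := by
    intro a b ha hb
    simp only [Set.mem_setOf_eq] at *
    exact lt_of_le_of_lt (IsUltrametricDist.norm_add_le_max (a : K) b) (max_lt ha hb)
  smul_mem' := by
    intro c x hx
    simp only [Set.mem_setOf_eq] at *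
    calc ‖((c • x : intRing K) : K)‖ = ‖(c : K)‖ * ‖(x : K)‖ := norm_mul _ _
    _ ≤ 1 * ‖(x : K)‖ := by gcongr; exact c.2
    _ < 1 := by simpa using hx

def kk := intRing K ⧸ maxIdl K

instance : CommRing (kk K) := Ideal.Quotient.commRing (maxIdl K)

def redCoeff (x : K) : kk K :=
  if h : ‖x‖ ≤ 1 then Ideal.Quotient.mk (maxIdl K) ⟨x, h⟩ else 0

def redPoly (F : MvPolynomial (Fin 2) K) : MvPolynomial (Fin 2) (kk K) :=
  ∑ m ∈ F.support, MvPolynomial.monomial m (redCoeff K (F.coeff m))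

/-- A pair of binary forms is a (homogeneous) lift of a degree-`d` rational map if both entries
are homogeneous of degree `d` and they are coprime. -/
def LiftPair (d : ℕ) (F G : MvPolynomial (Fin 2) K) : Prop :=
  F.IsHomogeneous d ∧ G.IsHomogeneous d ∧ IsRelPrime F G

/-- A pair of binary forms is normalized if all coefficients lie in `O`
and some coefficient has absolute value `1`. -/
def Normalized (F G : MvPolynomial (Fin 2) K) : Prop :=
  (∀ m, ‖F.coeff m‖ ≤ 1) ∧ (∀ m, ‖G.coeff m‖ ≤ 1) ∧
    (∃ m, ‖F.coeff m‖ = 1 ∨ ‖G.coeff m‖ = 1)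

/-- The maximum of the absolute values of the coefficients of a pair of degree-`e` binary forms. -/
def maxNorm (e : ℕ) (F G : MvPolynomial (Fin 2) K) : ℝ :=
  Finset.univ.sup' Finset.univ_nonempty
    (fun i : Fin (e + 1) => max ‖coeffVec e F i‖ ‖coeffVec e G i‖)

/-- `Rpair e F G` is the quantity `R_φ = ord(Res(F₀,G₀))` where `(F₀,G₀)` is the normalized
rescaling of the pair `(F,G)` of degree-`e` binary forms; equivalently it is
`ord(Res(F,G)) - 2·e·(minimal ord of a coefficient of F, G)`. -/
def Rpair (e : ℕ) (F G : MvPolynomial (Fin 2) K) : ℝ :=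
  ordv K (bres e F G) + 2 * e * Real.log (maxNorm K e F G)

/-- Linear substitution of a `2×2` matrix into a binary form. -/
def mobius (M : Matrix (Fin 2) (Fin 2) K) (F : MvPolynomial (Fin 2) K) :
    MvPolynomial (Fin 2) K :=
  MvPolynomial.aeval
    ![C (M 0 0) * X 0 + C (M 0 1) * X 1, C (M 1 0) * X 0 + C (M 1 1) * X 1] F

/-- The conjugate pair `γ⁻¹ ∘ (F,G) ∘ γ`, a homogeneous lift of `φ^γ = γ⁻¹ ∘ φ ∘ γ`. -/
def conjPair (M : GL (Fin 2) K) (F G : MvPolynomial (Fin 2) K) :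
    MvPolynomial (Fin 2) K × MvPolynomial (Fin 2) K :=
  (C ((M⁻¹ : GL (Fin 2) K) 0 0) * mobius K M F + C ((M⁻¹ : GL (Fin 2) K) 0 1) * mobius K M G,
   C ((M⁻¹ : GL (Fin 2) K) 1 0) * mobius K M F + C ((M⁻¹ : GL (Fin 2) K) 1 1) * mobius K M G)

/-- The minimal resultant `R_{[φ]} = inf_γ R_{φ^γ}` of (the map lifted by) a degree-`e` pair. -/
def Rmin (e : ℕ) (F G : MvPolynomial (Fin 2) K) : ℝ :=
  ⨅ M : GL (Fin 2) K, Rpair K e (conjPair K M F G).1 (conjPair K M F G).2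

/-- `Ilocus d F G` says the reduction of the normalized pair `(F,G)` lies in the indeterminacy
locus `I(d)`: the reduced pair is proportional, i.e. `(F̃, G̃) = (a·C, b·C)` with `[a:b] ∈ P¹(k)`
(so that the residue map is the constant `[a:b]`), and the constant value `[a:b]`
is a root of the common factor `C` (which is the gcd `Ã` of `F̃` and `G̃`). -/
def Ilocus (d : ℕ) (F G : MvPolynomial (Fin 2) K) : Prop :=
  ∃ (a b : kk K) (Cf : MvPolynomial (Fin 2) (kk K)),
    ¬(a = 0 ∧ b = 0) ∧ Cf.IsHomogeneous d ∧
    redPoly K F = MvPolynomial.C a * Cf ∧ redPoly K G = MvPolynomial.C b * Cf ∧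
    MvPolynomial.eval ![a, b] Cf = 0

/-- `Semistable d F G` says the reduction of the normalized pair `(F,G)` is GIT-semistable
(Silverman's numerical criterion): writing `F̃ = Ã·F̃₀`, `G̃ = Ã·G̃₀` with `F̃₀, G̃₀` coprime,
every root `h = [a:b]` of `Ã` has multiplicity `r ≤ d/2` (`d` even), resp. `r ≤ (d+1)/2`
(`d` odd), and when the bound is attained additionally `φ̃(h) ≠ h`. -/
def Semistable (d : ℕ) (F G : MvPolynomial (Fin 2) K) : Prop :=
  ∃ (A F0 G0 : MvPolynomial (Fin 2) (kk K)) (e : ℕ),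
    e ≤ d ∧ A.IsHomogeneous (d - e) ∧ F0.IsHomogeneous e ∧ G0.IsHomogeneous e ∧
    redPoly K F = A * F0 ∧ redPoly K G = A * G0 ∧ IsRelPrime F0 G0 ∧
    ∀ (a b : kk K), ¬(a = 0 ∧ b = 0) → ∀ r : ℕ,
      (MvPolynomial.C b * X 0 - MvPolynomial.C a * X 1) ^ r ∣ A →
        2 * r ≤ d + 1 ∧
          (d ≤ 2 * r →
            b * MvPolynomial.eval ![a, b] F0 ≠ a * MvPolynomial.eval ![a, b] G0)

/-- The rational map lifted by the (not necessarily normalized) pair `(F,G)` has semistable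
reduction: some normalized rescaling is `Semistable`. -/
def HasSemistableRed (d : ℕ) (F G : MvPolynomial (Fin 2) K) : Prop :=
  ∃ c : Kˣ, Normalized K ((c : K) • F) ((c : K) • G) ∧
    Semistable K d ((c : K) • F) ((c : K) • G)

/-- The reduction of (a normalized rescaling of) the pair `(F,G)` lies outside `I(d)`. -/
def RedOutsideI (d : ℕ) (F G : MvPolynomial (Fin 2) K) : Prop :=
  ∃ c : Kˣ, Normalized K ((c : K) • F) ((c : K) • G) ∧
    ¬ Ilocus K d ((c : K) • F) ((c : K) • G)

/-- The `m`-th term (`m ≥ 1`) of Tate's series `x(w)`. -/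
def tateTerm (q w : K) (m : ℕ) : K :=
  q ^ m * w / (1 - q ^ m * w) ^ 2 + q ^ m * w⁻¹ / (1 - q ^ m * w⁻¹) ^ 2
    - 2 * (q ^ m / (1 - q ^ m) ^ 2)

/-- Tate's series `x(w)` for the Tate curve with parameter `q`. -/
def xTate (q w : K) : K :=
  w / (1 - w) ^ 2 + ∑' m : ℕ, tateTerm K q w (m + 1)

set_option linter.unusedSectionVars false

section Dehomogenize

variable {K}

/-- Dehomogenization `F ↦ F(X, 1)`. -/
def dehom (F : MvPolynomial (Fin 2) K) : Polynomial K :=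
  MvPolynomial.aeval ![Polynomial.X, 1] F

lemma degree_eq_of_mem_support {d : ℕ} {F : MvPolynomial (Fin 2) K} (hF : F.IsHomogeneous d)
    {s : Fin 2 →₀ ℕ} (hs : s ∈ F.support) : s 0 + s 1 = d := by
  have := hF (MvPolynomial.mem_support_iff.mp hs)
  rw [Finsupp.weight_apply, Finsupp.sum_fintype _ _ (by simp)] at this
  simpa using this

lemma dehom_eq_sum (F : MvPolynomial (Fin 2) K) :
    dehom F = ∑ s ∈ F.support, Polynomial.C (F.coeff s) * Polynomial.X ^ s 0 := by
  simp [dehom, MvPolynomial.aeval_def, MvPolynomial.eval₂_eq', Fin.prod_univ_two]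

lemma eval_dehom (F : MvPolynomial (Fin 2) K) (x : K) :
    (dehom F).eval x = MvPolynomial.eval ![x, 1] F := by
  rw [dehom_eq_sum, MvPolynomial.eval_eq', Polynomial.eval_finsetSum]
  simp [Fin.prod_univ_two]

lemma coeff_dehom {d : ℕ} {F : MvPolynomial (Fin 2) K} (hF : F.IsHomogeneous d) {i : ℕ}
    (hi : i ≤ d) :
    (dehom F).coeff i = F.coeff (Finsupp.single 0 i + Finsupp.single 1 (d - i)) := by
  rw [dehom_eq_sum, Polynomial.finsetSum_coeff]
  rw [Finset.sum_eq_single (Finsupp.single 0 i + Finsupp.single 1 (d - i))]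
  · simp
  · intro s hs hne
    have := degree_eq_of_mem_support hF hs
    simp only [Polynomial.coeff_C_mul, Polynomial.coeff_X_pow]
    rw [if_neg, mul_zero]
    rintro rfl
    apply hne
    ext j
    fin_cases j
    · simp
    · simp
      omega
  · intro h
    simp only [MvPolynomial.mem_support_iff, not_not] at h
    rw [h, Polynomial.C_0, zero_mul, Polynomial.coeff_zero]

lemma natDegree_dehom_le {d : ℕ} {F : MvPolynomial (Fin 2) K} (hF : F.IsHomogeneous d) :
    (dehom F).natDegree ≤ d := by
  rw [dehom_eq_sum]
  refine Polynomial.natDegree_sum_le_of_forall_le _ _ fun s hs => ?_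
  refine (Polynomial.natDegree_C_mul_X_pow_le _ _).trans ?_
  have := degree_eq_of_mem_support hF hs
  omega

lemma coeffVec_eq_coeff_dehom {d : ℕ} {F : MvPolynomial (Fin 2) K} (hF : F.IsHomogeneous d)
    (i : Fin (d + 1)) : coeffVec d F i = (dehom F).coeff (d - i) := by
  rw [coeff_dehom hF (Nat.sub_le _ _), coeffVec]
  congr
  omega

lemma bres_eq_resultant {d : ℕ} {F G : MvPolynomial (Fin 2) K} (hF : F.IsHomogeneous d)
    (hG : G.IsHomogeneous d) :
    bres d F G = (dehom F).resultant (dehom G) d d := by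
  rw [bres, Polynomial.resultant, ← Matrix.det_transpose,
    ← Matrix.det_submatrix_equiv_self (Fin.revPerm) (sylv d _ _)ᵀ]
  congr 1
  ext i j
  simp only [Matrix.submatrix_apply, Matrix.transpose_apply, sylv, Matrix.of_apply,
    Polynomial.sylvester, Fin.revPerm_apply, Fin.val_rev]
  induction j using Fin.addCases with
  | left j =>
    have hi := i.2
    have hj := j.2
    simp only [Fin.val_castAdd, Fin.addCases_left, Set.mem_Icc]
    rw [dif_neg (by omega)]
    by_cases h : (j : ℕ) ≤ i ∧ (i : ℕ) ≤ j + d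
    · rw [dif_pos (by omega), if_pos h, coeffVec_eq_coeff_dehom hG]
      congr 1
      simp only
      omega
    · rw [dif_neg (by omega), if_neg h]
  | right j =>
    have hi := i.2
    have hj := j.2
    simp only [Fin.val_natAdd, Fin.addCases_right, Set.mem_Icc]
    rw [dif_pos (by omega)]
    by_cases h : (j : ℕ) ≤ i ∧ (i : ℕ) ≤ j + d
    · rw [dif_pos (by omega), if_pos h, coeffVec_eq_coeff_dehom hF]
      congr 1
      simp only
      omega
    · rw [dif_neg (by omega), if_neg h]

lemma norm_coeff_dehom_le_maxNorm {d : ℕ} {F G : MvPolynomial (Fin 2) K}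
    (hF : F.IsHomogeneous d) (hG : G.IsHomogeneous d) {i : ℕ} (hi : i ≤ d) :
    ‖(dehom F).coeff i‖ ≤ maxNorm K d F G ∧ ‖(dehom G).coeff i‖ ≤ maxNorm K d F G := by
  have h := Finset.le_sup' (fun i : Fin (d + 1) => max ‖coeffVec d F i‖ ‖coeffVec d G i‖)
    (Finset.mem_univ ⟨d - i, by omega⟩)
  rw [coeffVec_eq_coeff_dehom hF, coeffVec_eq_coeff_dehom hG] at h
  simp only [Nat.sub_sub_self hi] at h
  exact ⟨(le_max_left _ _).trans h, (le_max_right _ _).trans h⟩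

lemma maxNorm_le_iff {d : ℕ} {F G : MvPolynomial (Fin 2) K}
    (hF : F.IsHomogeneous d) (hG : G.IsHomogeneous d) {c : ℝ} :
    maxNorm K d F G ≤ c ↔
      ∀ i ≤ d, ‖(dehom F).coeff i‖ ≤ c ∧ ‖(dehom G).coeff i‖ ≤ c := by
  constructor
  · intro h i hi
    have := norm_coeff_dehom_le_maxNorm hF hG hi
    exact ⟨this.1.trans h, this.2.trans h⟩
  · intro h
    refine Finset.sup'_le _ _ fun i _ => ?_
    rw [coeffVec_eq_coeff_dehom hF, coeffVec_eq_coeff_dehom hG]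
    exact max_le (h _ (Nat.sub_le _ _)).1 (h _ (Nat.sub_le _ _)).2

lemma maxNorm_le_iff_coeff {d : ℕ} {F G : MvPolynomial (Fin 2) K}
    (hF : F.IsHomogeneous d) (hG : G.IsHomogeneous d) {c : ℝ} (hc : 0 ≤ c) :
    maxNorm K d F G ≤ c ↔ (∀ s, ‖F.coeff s‖ ≤ c) ∧ ∀ s, ‖G.coeff s‖ ≤ c := by
  rw [maxNorm_le_iff hF hG]
  have key : ∀ P : MvPolynomial (Fin 2) K, P.IsHomogeneous d →
      ((∀ i ≤ d, ‖(dehom P).coeff i‖ ≤ c) ↔ ∀ s, ‖P.coeff s‖ ≤ c) := by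
    intro P hP
    constructor
    · intro h s
      by_cases hs : s ∈ P.support
      · have hd := degree_eq_of_mem_support hP hs
        have := h (s 0) (by omega)
        rw [coeff_dehom hP (by omega)] at this
        convert this
        ext j
        fin_cases j
        · simp
        · simp
          omega
      · rw [MvPolynomial.mem_support_iff, not_not] at hs
        simpa [hs] using hc
    · intro h i hi
      rw [coeff_dehom hP hi]
      exact h _
  rw [← key F hF, ← key G hG]
  exact ⟨fun h => ⟨fun i hi => (h i hi).1, fun i hi => (h i hi).2⟩,
    fun h i hi => ⟨h.1 i hi, h.2 i hi⟩⟩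

end Dehomogenize

section Conjugation

variable {K}

lemma mobius_mul (A B : Matrix (Fin 2) (Fin 2) K) (F : MvPolynomial (Fin 2) K) :
    mobius K (A * B) F = mobius K B (mobius K A F) := by
  unfold mobius
  rw [← AlgHom.comp_apply]
  congr 1
  refine MvPolynomial.algHom_ext fun i => ?_
  fin_cases i <;>
  · simp [Matrix.mul_apply, Fin.sum_univ_two, MvPolynomial.algebraMap_eq]
    ring

lemma mobius_isHomogeneous {d : ℕ} (A : Matrix (Fin 2) (Fin 2) K) {F : MvPolynomial (Fin 2) K}
    (hF : F.IsHomogeneous d) : (mobius K A F).IsHomogeneous d := by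
  have := hF.aeval (![C (A 0 0) * X 0 + C (A 0 1) * X 1,
    C (A 1 0) * X 0 + C (A 1 1) * X 1] : Fin 2 → MvPolynomial (Fin 2) K) (n := 1) (by
      intro i
      fin_cases i <;>
      exact ((isHomogeneous_C_mul_X _ _).add (isHomogeneous_C_mul_X _ _)))
  simpa [mobius] using this

lemma conjPair_isHomogeneous {d : ℕ} (M : GL (Fin 2) K) {F G : MvPolynomial (Fin 2) K}
    (hF : F.IsHomogeneous d) (hG : G.IsHomogeneous d) :
    (conjPair K M F G).1.IsHomogeneous d ∧ (conjPair K M F G).2.IsHomogeneous d := by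
  have hF' := mobius_isHomogeneous (M : Matrix (Fin 2) (Fin 2) K) hF
  have hG' := mobius_isHomogeneous (M : Matrix (Fin 2) (Fin 2) K) hG
  exact ⟨(hF'.C_mul _).add (hG'.C_mul _), (hF'.C_mul _).add (hG'.C_mul _)⟩

lemma conjPair_mul (M N : GL (Fin 2) K) (F G : MvPolynomial (Fin 2) K) :
    conjPair K (M * N) F G = conjPair K N (conjPair K M F G).1 (conjPair K M F G).2 := by
  have h : ∀ (a b : K), mobius K (N : Matrix (Fin 2) (Fin 2) K)
      (C a * mobius K (M : Matrix (Fin 2) (Fin 2) K) F +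
        C b * mobius K (M : Matrix (Fin 2) (Fin 2) K) G) =
      C a * mobius K ((M * N : GL (Fin 2) K) : Matrix (Fin 2) (Fin 2) K) F +
        C b * mobius K ((M * N : GL (Fin 2) K) : Matrix (Fin 2) (Fin 2) K) G := by
    intro a b
    rw [Units.val_mul, mobius_mul, mobius_mul]
    simp [mobius, MvPolynomial.algebraMap_eq]
  have hi : ∀ i j, ((M * N)⁻¹ : GL (Fin 2) K) i j =
      (N⁻¹ : GL (Fin 2) K) i 0 * (M⁻¹ : GL (Fin 2) K) 0 j +
      (N⁻¹ : GL (Fin 2) K) i 1 * (M⁻¹ : GL (Fin 2) K) 1 j := by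
    intro i j
    rw [_root_.mul_inv_rev, Units.val_mul, Matrix.mul_apply, Fin.sum_univ_two]
  unfold conjPair
  ext1 <;> simp only [h, hi, C_add, C_mul] <;> ring

/-- The coordinate swap. -/
def swapGL : GL (Fin 2) K :=
  ⟨!![0, 1; 1, 0], !![0, 1; 1, 0], by simp [Matrix.one_fin_two], by simp [Matrix.one_fin_two]⟩

/-- Lower unitriangular matrices. -/
def lowerGL (c : K) : GL (Fin 2) K :=
  ⟨!![1, 0; c, 1], !![1, 0; -c, 1], by simp [Matrix.one_fin_two], by simp [Matrix.one_fin_two]⟩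

/-- Upper triangular matrices. -/
def upperGL (a b e : K) (ha : a ≠ 0) (he : e ≠ 0) : GL (Fin 2) K :=
  ⟨!![a, b; 0, e], !![a⁻¹, -(b / (a * e)); 0, e⁻¹], by
    simp [Matrix.one_fin_two, ha, he]; field_simp; simp, by
    simp [Matrix.one_fin_two, ha, he]; field_simp; simp⟩

lemma eq_upperGL_mul_lowerGL (M : GL (Fin 2) K) (h : M 1 1 ≠ 0) :
    ∃ ha, M = upperGL (M 0 0 - M 0 1 * (M 1 0 / M 1 1)) (M 0 1) (M 1 1) ha h *
      lowerGL (M 1 0 / M 1 1) := by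
  have hdet : M 0 0 * M 1 1 - M 0 1 * M 1 0 ≠ 0 := by
    rw [← Matrix.det_fin_two]
    exact ((Matrix.isUnit_iff_isUnit_det _).mp M.isUnit).ne_zero
  have ha : M 0 0 - M 0 1 * (M 1 0 / M 1 1) ≠ 0 := by
    intro h0
    apply hdet
    field_simp at h0
    linear_combination h0
  refine ⟨ha, Units.ext ?_⟩
  ext i j
  rw [Units.val_mul]
  fin_cases i <;> fin_cases j <;> simp [upperGL, lowerGL, Matrix.mul_apply, Fin.sum_univ_two]
  · field_simp

lemma lowerGL_eq (c : K) :
    lowerGL c = swapGL * upperGL 1 c 1 one_ne_zero one_ne_zero * swapGL := by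
  refine Units.ext ?_
  ext i j
  fin_cases i <;> fin_cases j <;>
    simp [upperGL, lowerGL, swapGL]

lemma swapGL_mul_swapGL : (swapGL : GL (Fin 2) K) * swapGL = 1 := by
  refine Units.ext ?_
  simp [swapGL, Matrix.one_fin_two]

lemma conjPair_swapGL (F G : MvPolynomial (Fin 2) K) :
    conjPair K swapGL F G = (mobius K !![0, 1; 1, 0] G, mobius K !![0, 1; 1, 0] F) := by
  simp [conjPair, swapGL, Units.inv_mk]

lemma conjPair_upperGL (a b e : K) (ha : a ≠ 0) (he : e ≠ 0) (F G : MvPolynomial (Fin 2) K) :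
    conjPair K (upperGL a b e ha he) F G =
      (C a⁻¹ * mobius K !![a, b; 0, e] F + C (-(b / (a * e))) * mobius K !![a, b; 0, e] G,
        C e⁻¹ * mobius K !![a, b; 0, e] G) := by
  simp [conjPair, upperGL, Units.inv_mk]

lemma dehom_add (F G : MvPolynomial (Fin 2) K) : dehom (F + G) = dehom F + dehom G :=
  map_add (MvPolynomial.aeval _) F G

lemma dehom_C_mul (a : K) (F : MvPolynomial (Fin 2) K) :
    dehom (C a * F) = Polynomial.C a * dehom F := by
  simp [dehom]

lemma dehom_mobius_upper {d : ℕ} (a b e : K) (he : e ≠ 0) {F : MvPolynomial (Fin 2) K}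
    (hF : F.IsHomogeneous d) :
    dehom (mobius K !![a, b; 0, e] F) = Polynomial.C (e ^ d) *
      (dehom F).comp (Polynomial.C (a / e) * Polynomial.X + Polynomial.C (b / e)) := by
  have h1 : dehom (mobius K !![a, b; 0, e] F) =
      MvPolynomial.aeval ![Polynomial.C a * Polynomial.X + Polynomial.C b, Polynomial.C e] F := by
    rw [dehom, mobius, ← AlgHom.comp_apply]
    congr 1
    refine MvPolynomial.algHom_ext fun i => ?_
    fin_cases i <;> simp
  rw [h1, MvPolynomial.aeval_def, MvPolynomial.eval₂_eq', dehom_eq_sum,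
    Polynomial.sum_comp, Finset.mul_sum]
  refine Finset.sum_congr rfl fun s hs => ?_
  have hd := degree_eq_of_mem_support hF hs
  have h2 : (Polynomial.C a * Polynomial.X + Polynomial.C b : Polynomial K) =
      Polynomial.C e * (Polynomial.C (a / e) * Polynomial.X + Polynomial.C (b / e)) := by
    rw [mul_add, ← mul_assoc, ← Polynomial.C_mul, ← Polynomial.C_mul, mul_div_cancel₀ _ he,
      mul_div_cancel₀ _ he]
  simp only [Fin.prod_univ_two, Matrix.cons_val_zero, Matrix.cons_val_one, h2,
    Polynomial.algebraMap_eq, Polynomial.mul_comp, Polynomial.C_comp, Polynomial.pow_comp,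
    Polynomial.X_comp, ← hd, pow_add, Polynomial.C_mul, Polynomial.C_pow, mul_pow]
  ring

lemma coeff_dehom_mobius_swap {d : ℕ} {F : MvPolynomial (Fin 2) K} (hF : F.IsHomogeneous d)
    {i : ℕ} (hi : i ≤ d) :
    (dehom (mobius K !![0, 1; 1, 0] F)).coeff i = (dehom F).coeff (d - i) := by
  have h1 : dehom (mobius K !![0, 1; 1, 0] F) =
      MvPolynomial.aeval ![1, Polynomial.X] F := by
    rw [dehom, mobius, ← AlgHom.comp_apply]
    congr 1
    refine MvPolynomial.algHom_ext fun i => ?_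
    fin_cases i <;> simp
  rw [h1, MvPolynomial.aeval_def, MvPolynomial.eval₂_eq', dehom_eq_sum,
    Polynomial.finsetSum_coeff, Polynomial.finsetSum_coeff]
  refine Finset.sum_congr rfl fun s hs => ?_
  have hd := degree_eq_of_mem_support hF hs
  simp only [Fin.prod_univ_two, Matrix.cons_val_zero, Matrix.cons_val_one, one_pow, one_mul,
    Polynomial.algebraMap_eq, Polynomial.coeff_C_mul, Polynomial.coeff_X_pow]
  congr 2
  apply propext
  omega

lemma bres_mobius_swap {d : ℕ} {F G : MvPolynomial (Fin 2) K} (hF : F.IsHomogeneous d)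
    (hG : G.IsHomogeneous d) :
    bres d (mobius K !![0, 1; 1, 0] G) (mobius K !![0, 1; 1, 0] F) = bres d F G := by
  rw [bres, bres, ← Matrix.det_submatrix_equiv_self (Fin.revPerm) (sylv d _ _)]
  have hv : ∀ P : MvPolynomial (Fin 2) K, P.IsHomogeneous d → ∀ i j : Fin (d + 1),
      (i : ℕ) + j = d → coeffVec d (mobius K !![0, 1; 1, 0] P) i = coeffVec d P j := by
    intro P hP i j hij
    rw [coeffVec_eq_coeff_dehom hP, coeffVec_eq_coeff_dehom (mobius_isHomogeneous _ hP),
      coeff_dehom_mobius_swap hP (by omega)]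
    congr 1
    omega
  congr 1
  ext i j
  have hi := i.2
  have hj := j.2
  simp only [Matrix.submatrix_apply, sylv, Matrix.of_apply, Fin.revPerm_apply, Fin.val_rev]
  by_cases hid : (i : ℕ) < d
  · rw [dif_neg (by omega), dif_pos hid]
    by_cases h : (i : ℕ) ≤ j ∧ (j : ℕ) ≤ i + d
    · rw [dif_pos (by omega), dif_pos h]
      exact hv F hF _ _ (by simp only; omega)
    · rw [dif_neg (by omega), dif_neg h]
  · rw [dif_pos (by omega), dif_neg hid]
    by_cases h : (i : ℕ) - d ≤ j ∧ (j : ℕ) ≤ i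
    · rw [dif_pos (by omega), dif_pos h]
      exact hv G hG _ _ (by simp only; omega)
    · rw [dif_neg (by omega), dif_neg h]

end Conjugation

section ResultantAndNorm

variable {K}

lemma norm_coeff_mul_le {P Q : MvPolynomial (Fin 2) K} {a b : ℝ} (ha : 0 ≤ a) (hb : 0 ≤ b)
    (hP : ∀ s, ‖P.coeff s‖ ≤ a) (hQ : ∀ s, ‖Q.coeff s‖ ≤ b) (s : Fin 2 →₀ ℕ) :
    ‖(P * Q).coeff s‖ ≤ a * b := by
  classical
  rw [MvPolynomial.coeff_mul]
  refine IsUltrametricDist.norm_sum_le_of_forall_le_of_nonneg (by positivity) fun x _ => ?_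
  rw [norm_mul]
  exact mul_le_mul (hP _) (hQ _) (norm_nonneg _) ha

lemma norm_coeff_pow_le_one {P : MvPolynomial (Fin 2) K}
    (hP : ∀ s, ‖P.coeff s‖ ≤ 1) (n : ℕ) (s : Fin 2 →₀ ℕ) :
    ‖(P ^ n).coeff s‖ ≤ 1 := by
  classical
  induction n generalizing s with
  | zero =>
    rw [pow_zero, MvPolynomial.coeff_one]
    split_ifs <;> simp
  | succ n ih =>
    rw [pow_succ]
    simpa using norm_coeff_mul_le zero_le_one zero_le_one ih hP s

lemma norm_coeff_C_mul_X_add_le_one {a b : K} (ha : ‖a‖ ≤ 1) (hb : ‖b‖ ≤ 1) (s : Fin 2 →₀ ℕ) :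
    ‖(C a * X 0 + C b * X 1 : MvPolynomial (Fin 2) K).coeff s‖ ≤ 1 := by
  classical
  rw [MvPolynomial.coeff_add]
  refine (IsUltrametricDist.norm_add_le_max _ _).trans (max_le ?_ ?_) <;>
  · rw [MvPolynomial.coeff_C_mul, MvPolynomial.coeff_X]
    split_ifs <;> simp [ha, hb]

lemma norm_coeff_mobius_le {A : Matrix (Fin 2) (Fin 2) K} (hA : ∀ i j, ‖A i j‖ ≤ 1)
    {F : MvPolynomial (Fin 2) K} {c : ℝ} (hc : 0 ≤ c) (hF : ∀ s, ‖F.coeff s‖ ≤ c)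
    (s : Fin 2 →₀ ℕ) : ‖(mobius K A F).coeff s‖ ≤ c := by
  rw [mobius, MvPolynomial.aeval_def, MvPolynomial.eval₂_eq', MvPolynomial.coeff_sum]
  refine IsUltrametricDist.norm_sum_le_of_forall_le_of_nonneg hc fun x _ => ?_
  rw [MvPolynomial.algebraMap_eq, MvPolynomial.coeff_C_mul, norm_mul]
  have h : ‖MvPolynomial.coeff s (∏ i, (![C (A 0 0) * X 0 + C (A 0 1) * X 1,
      C (A 1 0) * X 0 + C (A 1 1) * X 1] : Fin 2 → MvPolynomial (Fin 2) K) i ^ x i)‖ ≤ 1 := by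
    rw [Fin.prod_univ_two]
    simpa using norm_coeff_mul_le zero_le_one zero_le_one
      (norm_coeff_pow_le_one (norm_coeff_C_mul_X_add_le_one (hA 0 0) (hA 0 1)) (x 0))
      (norm_coeff_pow_le_one (norm_coeff_C_mul_X_add_le_one (hA 1 0) (hA 1 1)) (x 1)) s
  calc _ ≤ c * 1 := mul_le_mul (hF _) h (norm_nonneg _) hc
    _ = c := mul_one c

lemma maxNorm_nonneg (d : ℕ) (F G : MvPolynomial (Fin 2) K) : 0 ≤ maxNorm K d F G :=
  (le_max_of_le_left (norm_nonneg _)).trans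
    (Finset.le_sup' (fun i : Fin (d + 1) => max ‖coeffVec d F i‖ ‖coeffVec d G i‖)
      (Finset.mem_univ 0))

lemma maxNorm_conjPair_le {d : ℕ} {F G : MvPolynomial (Fin 2) K} (hF : F.IsHomogeneous d)
    (hG : G.IsHomogeneous d) (k : GL (Fin 2) K) (hk : ∀ i j, ‖k i j‖ ≤ 1)
    (hk' : ∀ i j, ‖(k⁻¹ : GL (Fin 2) K) i j‖ ≤ 1) :
    maxNorm K d (conjPair K k F G).1 (conjPair K k F G).2 ≤ maxNorm K d F G := by
  have hc := maxNorm_nonneg d F G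
  have h := (maxNorm_le_iff_coeff hF hG hc).mp le_rfl
  have hh := conjPair_isHomogeneous k hF hG
  rw [maxNorm_le_iff_coeff hh.1 hh.2 hc]
  have key : ∀ a b : K, ‖a‖ ≤ 1 → ‖b‖ ≤ 1 → ∀ s,
      ‖(C a * mobius K (k : Matrix (Fin 2) (Fin 2) K) F +
        C b * mobius K (k : Matrix (Fin 2) (Fin 2) K) G).coeff s‖ ≤ maxNorm K d F G := by
    intro a b ha hb s
    rw [MvPolynomial.coeff_add, MvPolynomial.coeff_C_mul, MvPolynomial.coeff_C_mul]
    refine (IsUltrametricDist.norm_add_le_max _ _).trans (max_le ?_ ?_) <;> rw [norm_mul]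
    · simpa using mul_le_mul ha (norm_coeff_mobius_le hk hc h.1 s) (norm_nonneg _) zero_le_one
    · simpa using mul_le_mul hb (norm_coeff_mobius_le hk hc h.2 s) (norm_nonneg _) zero_le_one
  exact ⟨key _ _ (hk' 0 0) (hk' 0 1), key _ _ (hk' 1 0) (hk' 1 1)⟩

lemma maxNorm_conjPair_mul_eq {d : ℕ} {F G : MvPolynomial (Fin 2) K} (hF : F.IsHomogeneous d)
    (hG : G.IsHomogeneous d) (M k : GL (Fin 2) K) (hk : ∀ i j, ‖k i j‖ ≤ 1)
    (hk' : ∀ i j, ‖(k⁻¹ : GL (Fin 2) K) i j‖ ≤ 1) :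
    maxNorm K d (conjPair K (M * k) F G).1 (conjPair K (M * k) F G).2 =
      maxNorm K d (conjPair K M F G).1 (conjPair K M F G).2 := by
  have h1 := conjPair_isHomogeneous M hF hG
  have h2 := conjPair_isHomogeneous (M * k) hF hG
  refine le_antisymm ?_ ?_
  · rw [conjPair_mul]
    exact maxNorm_conjPair_le h1.1 h1.2 k hk hk'
  · have := maxNorm_conjPair_le h2.1 h2.2 k⁻¹ hk' (by simpa using hk)
    rwa [← conjPair_mul, mul_inv_cancel_right] at this

lemma resultant_comp_linear_of_natDegree_eq [IsAlgClosed K] {d : ℕ} {p r : Polynomial K}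
    (hp : p.natDegree = d) (hr : r.natDegree ≤ d) (a b : K) (ha : a ≠ 0) :
    (p.comp (Polynomial.C a * Polynomial.X + Polynomial.C b)).resultant
      (r.comp (Polynomial.C a * Polynomial.X + Polynomial.C b)) d d =
      a ^ (d * d) * p.resultant r d d := by
  set l := Polynomial.C a * Polynomial.X + Polynomial.C b with hl
  have hl1 : l.natDegree = 1 := Polynomial.natDegree_linear ha
  have hpl : (p.comp l).natDegree = d := by rw [Polynomial.natDegree_comp, hl1, hp, mul_one]
  have hrl : (r.comp l).natDegree ≤ d := by rw [Polynomial.natDegree_comp, hl1, mul_one]; exact hr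
  have h1 := Polynomial.resultant_eq_prod_eval (p.comp l) (r.comp l) d hrl (IsAlgClosed.splits _)
  have h2 := Polynomial.resultant_eq_prod_eval p r d hr (IsAlgClosed.splits _)
  rw [hpl] at h1
  rw [hp] at h2
  have hroots : p.roots = (p.comp l).roots.map l.eval := by
    rw [← Polynomial.map_roots_comp_C_mul_X_add_C p a b ha.isUnit]
    simp [hl]
  rw [h1, h2, Polynomial.leadingCoeff_comp (by rw [hl1]; exact one_ne_zero), hroots,
    Polynomial.leadingCoeff_linear ha, hp, mul_pow, ← pow_mul, Multiset.map_map]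
  have : (fun x => Polynomial.eval x (r.comp l)) = (fun x => Polynomial.eval x r) ∘ fun x =>
      Polynomial.eval x l := by
    funext x
    simp [Polynomial.eval_comp]
  rw [this]
  ring

lemma resultant_comp_linear [IsAlgClosed K] {d : ℕ} {p r : Polynomial K}
    (hp : p.natDegree ≤ d) (hr : r.natDegree ≤ d) (a b : K) (ha : a ≠ 0) :
    (p.comp (Polynomial.C a * Polynomial.X + Polynomial.C b)).resultant
      (r.comp (Polynomial.C a * Polynomial.X + Polynomial.C b)) d d =
      a ^ (d * d) * p.resultant r d d := by
  rcases hp.eq_or_lt with hp' | hp'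
  · exact resultant_comp_linear_of_natDegree_eq hp' hr a b ha
  rcases hr.eq_or_lt with hr' | hr'
  · rw [Polynomial.resultant_comm, resultant_comp_linear_of_natDegree_eq hr' hp a b ha,
      Polynomial.resultant_comm p]
    ring
  · have hl1 : (Polynomial.C a * Polynomial.X + Polynomial.C b).natDegree = 1 :=
      Polynomial.natDegree_linear ha
    rw [Polynomial.resultant_eq_zero_of_lt_lt _ _ _ _ hp' hr', mul_zero,
      Polynomial.resultant_eq_zero_of_lt_lt]
    · rwa [Polynomial.natDegree_comp, hl1, mul_one]
    · rwa [Polynomial.natDegree_comp, hl1, mul_one]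

lemma bres_conjPair_upperGL [IsAlgClosed K] {d : ℕ} (a b e : K) (ha : a ≠ 0) (he : e ≠ 0)
    {F G : MvPolynomial (Fin 2) K} (hF : F.IsHomogeneous d) (hG : G.IsHomogeneous d) :
    bres d (conjPair K (upperGL a b e ha he) F G).1 (conjPair K (upperGL a b e ha he) F G).2 *
      (a * e) ^ d = (a * e) ^ (d * d) * bres d F G := by
  have h := conjPair_isHomogeneous (upperGL a b e ha he) hF hG
  rw [bres_eq_resultant h.1 h.2, bres_eq_resultant hF hG, conjPair_upperGL]
  dsimp only
  rw [dehom_add, dehom_C_mul, dehom_C_mul, dehom_C_mul, dehom_mobius_upper a b e he hF,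
    dehom_mobius_upper a b e he hG]
  have hG1 : (Polynomial.C (e ^ d) * (dehom G).comp
      (Polynomial.C (a / e) * Polynomial.X + Polynomial.C (b / e))).natDegree ≤ d := by
    refine (Polynomial.natDegree_C_mul_le _ _).trans ?_
    rw [Polynomial.natDegree_comp, Polynomial.natDegree_linear (div_ne_zero ha he), mul_one]
    exact natDegree_dehom_le hG
  rw [Polynomial.resultant_C_mul_right, mul_comm (Polynomial.C (-(b / (a * e)))),
    Polynomial.resultant_add_mul_left _ _ _ _ _ (by simp) hG1, Polynomial.resultant_C_mul_left,
    Polynomial.resultant_C_mul_left, Polynomial.resultant_C_mul_right,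
    resultant_comp_linear (natDegree_dehom_le hF) (natDegree_dehom_le hG) _ _
      (div_ne_zero ha he)]
  simp only [div_pow, mul_pow, inv_pow, ← pow_mul]
  field_simp

lemma norm_bres_conjPair [IsAlgClosed K] {d : ℕ} (M : GL (Fin 2) K)
    {F G : MvPolynomial (Fin 2) K} (hF : F.IsHomogeneous d) (hG : G.IsHomogeneous d) :
    ‖bres d (conjPair K M F G).1 (conjPair K M F G).2‖ *
      ‖(M : Matrix (Fin 2) (Fin 2) K).det‖ ^ d =
    ‖(M : Matrix (Fin 2) (Fin 2) K).det‖ ^ (d * d) * ‖bres d F G‖ := by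
  let P : GL (Fin 2) K → Prop := fun M => ∀ F G : MvPolynomial (Fin 2) K,
    F.IsHomogeneous d → G.IsHomogeneous d →
    ‖bres d (conjPair K M F G).1 (conjPair K M F G).2‖ *
      ‖(M : Matrix (Fin 2) (Fin 2) K).det‖ ^ d =
    ‖(M : Matrix (Fin 2) (Fin 2) K).det‖ ^ (d * d) * ‖bres d F G‖
  have hmul : ∀ M N, P M → P N → P (M * N) := by
    intro M N hM hN F G hF hG
    have h := conjPair_isHomogeneous M hF hG
    have h1 := hM F G hF hG
    have h2 := hN _ _ h.1 h.2
    rw [conjPair_mul, Units.val_mul, Matrix.det_mul, norm_mul, mul_pow, mul_pow]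
    linear_combination ‖(M : Matrix (Fin 2) (Fin 2) K).det‖ ^ d * h2 +
      ‖(N : Matrix (Fin 2) (Fin 2) K).det‖ ^ (d * d) * h1
  have hupper : ∀ a b e ha he, P (upperGL a b e ha he) := by
    intro a b e ha he F G hF hG
    have := congrArg norm (bres_conjPair_upperGL a b e ha he hF hG)
    have hdet : ((upperGL a b e ha he : GL (Fin 2) K) : Matrix (Fin 2) (Fin 2) K).det = a * e := by
      simp [upperGL]
    rw [hdet]
    simpa only [norm_mul, norm_pow] using this
  have hswap : P swapGL := by
    intro F G hF hG
    have hdet : ((swapGL : GL (Fin 2) K) : Matrix (Fin 2) (Fin 2) K).det = -1 := by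
      simp [swapGL]
    rw [hdet, conjPair_swapGL, bres_mobius_swap hF hG]
    simp
  have hgen : ∀ M : GL (Fin 2) K, M 1 1 ≠ 0 → P M := by
    intro M hM
    obtain ⟨ha, h⟩ := eq_upperGL_mul_lowerGL M hM
    rw [h, lowerGL_eq]
    exact hmul _ _ (hupper _ _ _ _ _) (hmul _ _ (hmul _ _ hswap (hupper _ _ _ _ _)) hswap)
  by_cases h : M 1 1 = 0
  · have h10 : M 1 0 ≠ 0 := by
      intro h0
      have := ((Matrix.isUnit_iff_isUnit_det _).mp M.isUnit).ne_zero
      rw [Matrix.det_fin_two] at this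
      exact this (by rw [h, h0]; ring)
    have := hmul _ _ (hgen (M * swapGL) (by simpa [swapGL, Matrix.mul_apply] using h10)) hswap
    rw [mul_assoc, swapGL_mul_swapGL, mul_one] at this
    exact this F G hF hG
  · exact hgen M h F G hF hG

end ResultantAndNorm

section LowerBound

variable {K}

/-- The `j`-th coefficient of `p` has norm `c` and strictly dominates all the others. -/
def Dominant (p : Polynomial K) (j : ℕ) (c : ℝ) : Prop :=
  ‖p.coeff j‖ = c ∧ ∀ i, i ≠ j → ‖p.coeff i‖ < c

lemma Dominant.pos {p : Polynomial K} {j : ℕ} {c : ℝ} (h : Dominant p j c) : 0 < c :=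
  (norm_nonneg _).trans_lt (h.2 (j + 1) (by omega))

lemma Dominant.norm_coeff_le {p : Polynomial K} {j : ℕ} {c : ℝ} (h : Dominant p j c) (i : ℕ) :
    ‖p.coeff i‖ ≤ c := by
  rcases eq_or_ne i j with rfl | hi
  · exact h.1.le
  · exact (h.2 i hi).le

lemma norm_add_eq_of_lt {x y : K} {c : ℝ} (hx : ‖x‖ = c) (hy : ‖y‖ < c) : ‖x + y‖ = c := by
  rw [IsUltrametricDist.norm_add_eq_max_of_norm_ne_norm (by rw [hx]; exact hy.ne'), hx]
  exact max_eq_left hy.le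

lemma Dominant.norm_eval {p : Polynomial K} {j : ℕ} {c : ℝ} (h : Dominant p j c) {b : K}
    (hb : ‖b‖ = 1) : ‖p.eval b‖ = c := by
  have hj : j ∈ p.support := by
    rw [Polynomial.mem_support_iff, ← norm_pos_iff, h.1]
    exact h.pos
  rw [Polynomial.eval_eq_sum, Polynomial.sum, ← Finset.add_sum_erase _ _ hj]
  refine norm_add_eq_of_lt (by simp [hb, h.1]) ?_
  rcases (p.support.erase j).eq_empty_or_nonempty with he | he
  · simpa [he] using h.pos
  · obtain ⟨i, hi, hle⟩ := IsUltrametricDist.exists_norm_finsetSum_le_of_nonempty he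
      (fun i => p.coeff i * b ^ i)
    refine hle.trans_lt ?_
    simpa [hb] using h.2 i (Finset.ne_of_mem_erase hi)

lemma coeff_comp_linear (p : Polynomial K) (a b : K) (i : ℕ) :
    (p.comp (Polynomial.C a * Polynomial.X + Polynomial.C b)).coeff i =
      a ^ i * ∑ n ∈ p.support, (n.choose i : K) * p.coeff n * b ^ (n - i) := by
  have h : p.comp (Polynomial.C a * Polynomial.X + Polynomial.C b) =
      (Polynomial.taylor b p).comp (Polynomial.C a * Polynomial.X) := by
    rw [Polynomial.taylor_apply, Polynomial.comp_assoc]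
    simp
  rw [h, Polynomial.comp_C_mul_X_coeff, Polynomial.taylor_coeff, Polynomial.hasseDeriv_apply,
    Polynomial.sum, Polynomial.eval_finsetSum, mul_comm]
  simp

lemma norm_coeff_comp_linear_le {p : Polynomial K} {c : ℝ} (hp : ∀ i, ‖p.coeff i‖ ≤ c)
    (a : K) {b : K} (hb : ‖b‖ ≤ 1) (i : ℕ) :
    ‖(p.comp (Polynomial.C a * Polynomial.X + Polynomial.C b)).coeff i‖ ≤ ‖a‖ ^ i * c := by
  have hc : 0 ≤ c := (norm_nonneg _).trans (hp 0)
  rw [coeff_comp_linear, norm_mul, norm_pow]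
  refine mul_le_mul_of_nonneg_left ?_ (by positivity)
  refine IsUltrametricDist.norm_sum_le_of_forall_le_of_nonneg hc fun n _ => ?_
  rw [norm_mul, norm_mul, norm_pow]
  calc _ ≤ 1 * c * 1 := by
        gcongr
        · exact IsUltrametricDist.norm_natCast_le_one K _
        · exact hp n
        · exact pow_le_one₀ (norm_nonneg _) hb
    _ = c := by ring

lemma Dominant.norm_coeff_comp_linear {p : Polynomial K} {j : ℕ} {c : ℝ} (h : Dominant p j c)
    (a : K) {b : K} (hb : ‖b‖ ≤ 1) :
    ‖(p.comp (Polynomial.C a * Polynomial.X + Polynomial.C b)).coeff j‖ = ‖a‖ ^ j * c := by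
  have hj : j ∈ p.support := by
    rw [Polynomial.mem_support_iff, ← norm_pos_iff, h.1]
    exact h.pos
  rw [coeff_comp_linear, norm_mul, norm_pow, ← Finset.add_sum_erase _ _ hj]
  congr 1
  refine norm_add_eq_of_lt (by simp [h.1]) ?_
  rcases (p.support.erase j).eq_empty_or_nonempty with he | he
  · simpa [he] using h.pos
  · obtain ⟨i, hi, hle⟩ := IsUltrametricDist.exists_norm_finsetSum_le_of_nonempty he
      (fun n => (n.choose j : K) * p.coeff n * b ^ (n - j))
    refine hle.trans_lt ?_
    rw [norm_mul, norm_mul, norm_pow]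
    calc _ ≤ 1 * ‖p.coeff i‖ * 1 := by
          gcongr
          · exact IsUltrametricDist.norm_natCast_le_one K _
          · exact pow_le_one₀ (norm_nonneg _) hb
      _ < c := by simpa using h.2 i (Finset.ne_of_mem_erase hi)

lemma le_sq_maxNorm_conjPair_upperGL {d j l : ℕ} {c : ℝ} (hd : 1 ≤ d) (hjd : j ≤ d) (hld : l ≤ d)
    {F G : MvPolynomial (Fin 2) K} (hF : F.IsHomogeneous d) (hG : G.IsHomogeneous d)
    (DF : Dominant (dehom F) j c) (DG : Dominant (dehom G) l c)
    (h1 : 2 * j ≤ d + 1 ∨ 2 * l + 1 ≤ d) (a b e : K) (ha : a ≠ 0) (he : e ≠ 0)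
    (hae : ‖a‖ ≤ ‖e‖) (hbe : ‖b‖ ≤ ‖e‖) :
    ‖a * e‖ ^ (d - 1) * c ^ 2 ≤ maxNorm K d (conjPair K (upperGL a b e ha he) F G).1
      (conjPair K (upperGL a b e ha he) F G).2 ^ 2 := by
  have hh := conjPair_isHomogeneous (upperGL a b e ha he) hF hG
  set N := maxNorm K d (conjPair K (upperGL a b e ha he) F G).1
      (conjPair K (upperGL a b e ha he) F G).2 with hN
  have hle := (maxNorm_le_iff hh.1 hh.2 (c := N)).mp le_rfl
  have he' : 0 < ‖e‖ := norm_pos_iff.mpr he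
  have hα : ‖a / e‖ ≤ 1 := by rw [norm_div]; exact div_le_one_of_le₀ hae he'.le
  have hβ : ‖b / e‖ ≤ 1 := by rw [norm_div]; exact div_le_one_of_le₀ hbe he'.le
  have hα0 : 0 < ‖a / e‖ := norm_pos_iff.mpr (div_ne_zero ha he)
  obtain ⟨n, rfl⟩ : ∃ n, d = n + 1 := ⟨d - 1, by omega⟩
  have hc := DG.pos
  set L := Polynomial.C (a / e) * Polynomial.X + Polynomial.C (b / e) with hL
  have hGc : ∀ i ≤ n + 1, ‖e‖ ^ n * ‖((dehom G).comp L).coeff i‖ ≤ N := by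
    intro i hi
    have h := (hle i hi).2
    rw [conjPair_upperGL] at h
    dsimp only at h
    rw [dehom_C_mul, dehom_mobius_upper a b e he hG, ← hL, ← mul_assoc, ← Polynomial.C_mul,
      Polynomial.coeff_C_mul, pow_succ', inv_mul_cancel_left₀ he, norm_mul, norm_pow] at h
    exact h
  have hFc : ∀ i ≤ n + 1, ‖e‖ ^ n *
      ‖((dehom F).comp L).coeff i + -(b / e) * ((dehom G).comp L).coeff i‖ ≤ N * ‖a / e‖ := by
    intro i hi
    have h := (hle i hi).1
    rw [conjPair_upperGL] at h
    dsimp only at h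
    rw [dehom_add, dehom_C_mul, dehom_C_mul, dehom_mobius_upper a b e he hG,
      dehom_mobius_upper a b e he hF, ← hL, Polynomial.coeff_add, Polynomial.coeff_C_mul,
      Polynomial.coeff_C_mul, Polynomial.coeff_C_mul, Polynomial.coeff_C_mul] at h
    have h2 := mul_le_mul_of_nonneg_right h hα0.le
    rw [← norm_mul] at h2
    rw [← norm_pow, ← norm_mul]
    refine le_trans (le_of_eq ?_) h2
    congr 1
    field_simp
    ring
  have hae2 : ‖a * e‖ ^ n = (‖e‖ ^ n) ^ 2 * ‖a / e‖ ^ n := by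
    rw [norm_mul, norm_div, div_pow, mul_pow]
    field_simp
  have hsq : ‖a * e‖ ^ n ≤ (‖e‖ ^ n) ^ 2 := by
    rw [hae2]
    exact mul_le_of_le_one_right (by positivity) (pow_le_one₀ (norm_nonneg _) hα)
  rw [Nat.add_sub_cancel]
  rcases hβ.eq_or_lt with hβ' | hβ'
  · have h := hGc 0 (by omega)
    rw [Polynomial.coeff_zero_eq_eval_zero, Polynomial.eval_comp, hL] at h
    simp only [Polynomial.eval_add, Polynomial.eval_mul, Polynomial.eval_C, Polynomial.eval_X,
      mul_zero, zero_add] at h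
    rw [DG.norm_eval hβ'] at h
    calc _ ≤ (‖e‖ ^ n) ^ 2 * c ^ 2 := by gcongr
      _ = (‖e‖ ^ n * c) ^ 2 := by ring
      _ ≤ _ := by gcongr
  rcases h1 with h1 | h1
  · have h := hFc j hjd
    rw [norm_add_eq_of_lt (DF.norm_coeff_comp_linear (a / e) hβ)] at h
    · have h3 : (‖e‖ ^ n * (‖a / e‖ ^ j * c)) ^ 2 ≤ (N * ‖a / e‖) ^ 2 := by gcongr
      have h4 : ‖a / e‖ ^ (n + 2) ≤ ‖a / e‖ ^ (2 * j) :=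
        pow_le_pow_of_le_one hα0.le hα (by omega)
      rw [hae2]
      refine le_of_mul_le_mul_right ?_ (pow_pos hα0 2)
      calc _ = (‖e‖ ^ n) ^ 2 * c ^ 2 * ‖a / e‖ ^ (n + 2) := by ring
        _ ≤ (‖e‖ ^ n) ^ 2 * c ^ 2 * ‖a / e‖ ^ (2 * j) := by gcongr
        _ = (‖e‖ ^ n * (‖a / e‖ ^ j * c)) ^ 2 := by ring
        _ ≤ (N * ‖a / e‖) ^ 2 := h3
        _ = _ := by ring
    · rw [norm_mul, norm_neg]
      calc _ ≤ ‖b / e‖ * (‖a / e‖ ^ j * c) := by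
            gcongr
            exact norm_coeff_comp_linear_le DG.norm_coeff_le _ hβ j
        _ < 1 * (‖a / e‖ ^ j * c) := by gcongr
        _ = _ := one_mul _
  · have h := hGc l hld
    rw [DG.norm_coeff_comp_linear (a / e) hβ] at h
    have h3 : (‖e‖ ^ n * (‖a / e‖ ^ l * c)) ^ 2 ≤ N ^ 2 := by gcongr
    have h4 : ‖a / e‖ ^ n ≤ ‖a / e‖ ^ (2 * l) :=
      pow_le_pow_of_le_one hα0.le hα (by omega)
    rw [hae2]
    calc _ = (‖e‖ ^ n) ^ 2 * c ^ 2 * ‖a / e‖ ^ n := by ring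
      _ ≤ (‖e‖ ^ n) ^ 2 * c ^ 2 * ‖a / e‖ ^ (2 * l) := by gcongr
      _ = (‖e‖ ^ n * (‖a / e‖ ^ l * c)) ^ 2 := by ring
      _ ≤ _ := h3

lemma le_sq_maxNorm_conjPair_of_max {d j l : ℕ} {c : ℝ} (hd : 1 ≤ d) (hjd : j ≤ d) (hld : l ≤ d)
    {F G : MvPolynomial (Fin 2) K} (hF : F.IsHomogeneous d) (hG : G.IsHomogeneous d)
    (DF : Dominant (dehom F) j c) (DG : Dominant (dehom G) l c)
    (h1 : 2 * j ≤ d + 1 ∨ 2 * l + 1 ≤ d) (M : GL (Fin 2) K) (hM : ∀ i k, ‖M i k‖ ≤ ‖M 1 1‖) :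
    ‖(M : Matrix (Fin 2) (Fin 2) K).det‖ ^ (d - 1) * c ^ 2 ≤
      maxNorm K d (conjPair K M F G).1 (conjPair K M F G).2 ^ 2 := by
  have hdet := ((Matrix.isUnit_iff_isUnit_det _).mp M.isUnit).ne_zero
  have h0 : M 1 1 ≠ 0 := by
    intro h0
    have : ∀ i k, M i k = 0 := by
      intro i k
      have := hM i k
      rwa [h0, norm_zero, norm_le_zero_iff] at this
    rw [Matrix.det_fin_two] at hdet
    exact hdet (by rw [this 0 0, this 0 1]; ring)
  have h0' : 0 < ‖M 1 1‖ := norm_pos_iff.mpr h0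
  obtain ⟨ha, h⟩ := eq_upperGL_mul_lowerGL M h0
  have hc1 : ‖M 1 0 / M 1 1‖ ≤ 1 := by
    rw [norm_div]
    exact div_le_one_of_le₀ (hM 1 0) h0'.le
  have ha1 : ‖M 0 0 - M 0 1 * (M 1 0 / M 1 1)‖ ≤ ‖M 1 1‖ := by
    rw [sub_eq_add_neg]
    refine (IsUltrametricDist.norm_add_le_max _ _).trans (max_le (hM 0 0) ?_)
    rw [norm_neg, norm_mul]
    simpa using mul_le_mul (hM 0 1) hc1 (norm_nonneg _) h0'.le
  have key := le_sq_maxNorm_conjPair_upperGL hd hjd hld hF hG DF DG h1 _ (M 0 1) (M 1 1) ha h0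
    ha1 (hM 0 1)
  have hdet' : (M : Matrix (Fin 2) (Fin 2) K).det =
      (M 0 0 - M 0 1 * (M 1 0 / M 1 1)) * M 1 1 := by
    rw [Matrix.det_fin_two]
    field_simp
  have hlow : ∀ x : K, ‖x‖ ≤ 1 → (∀ i k, ‖(lowerGL x : GL (Fin 2) K) i k‖ ≤ 1) ∧
      ∀ i k, ‖((lowerGL x)⁻¹ : GL (Fin 2) K) i k‖ ≤ 1 := by
    intro x hx
    constructor <;> intro i k <;> fin_cases i <;> fin_cases k <;>
      simp [lowerGL, Units.inv_mk, hx]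
  rw [h, maxNorm_conjPair_mul_eq hF hG _ _ (hlow _ hc1).1 (hlow _ hc1).2, ← h, hdet']
  exact key

lemma norm_swapGL_le : (∀ i k, ‖(swapGL : GL (Fin 2) K) i k‖ ≤ 1) ∧
    ∀ i k, ‖((swapGL)⁻¹ : GL (Fin 2) K) i k‖ ≤ 1 := by
  constructor <;> intro i k <;> fin_cases i <;> fin_cases k <;>
    simp [swapGL, Units.inv_mk]

lemma le_sq_maxNorm_conjPair_of_row {d j l : ℕ} {c : ℝ} (hd : 1 ≤ d) (hjd : j ≤ d) (hld : l ≤ d)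
    {F G : MvPolynomial (Fin 2) K} (hF : F.IsHomogeneous d) (hG : G.IsHomogeneous d)
    (DF : Dominant (dehom F) j c) (DG : Dominant (dehom G) l c)
    (h1 : 2 * j ≤ d + 1 ∨ 2 * l + 1 ≤ d) (M : GL (Fin 2) K) (k₀ : Fin 2)
    (hM : ∀ i k, ‖M i k‖ ≤ ‖M 1 k₀‖) :
    ‖(M : Matrix (Fin 2) (Fin 2) K).det‖ ^ (d - 1) * c ^ 2 ≤
      maxNorm K d (conjPair K M F G).1 (conjPair K M F G).2 ^ 2 := by
  fin_cases k₀
  · have := le_sq_maxNorm_conjPair_of_max hd hjd hld hF hG DF DG h1 (M * swapGL) (by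
      intro i k
      fin_cases k
      · simpa [swapGL, Matrix.mul_apply] using hM i 1
      · simpa [swapGL, Matrix.mul_apply] using hM i 0)
    rw [maxNorm_conjPair_mul_eq hF hG M swapGL norm_swapGL_le.1 norm_swapGL_le.2,
      Units.val_mul, Matrix.det_mul] at this
    simpa [swapGL] using this
  · exact le_sq_maxNorm_conjPair_of_max hd hjd hld hF hG DF DG h1 M hM

lemma Dominant.mobius_swap {d j : ℕ} {c : ℝ} (hjd : j ≤ d) {F : MvPolynomial (Fin 2) K}
    (hF : F.IsHomogeneous d) (DF : Dominant (dehom F) j c) :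
    Dominant (dehom (mobius K !![0, 1; 1, 0] F)) (d - j) c := by
  refine ⟨?_, fun i hi => ?_⟩
  · rw [coeff_dehom_mobius_swap hF (Nat.sub_le _ _), Nat.sub_sub_self hjd, DF.1]
  · rcases le_or_gt i d with hid | hid
    · rw [coeff_dehom_mobius_swap hF hid]
      exact DF.2 _ (by omega)
    · rw [Polynomial.coeff_eq_zero_of_natDegree_lt
        ((natDegree_dehom_le (mobius_isHomogeneous _ hF)).trans_lt hid), norm_zero]
      exact DF.pos

/-- A pair whose dominant coefficients are in stable position minimizes the normalized size of
its conjugates. -/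
theorem le_sq_maxNorm_conjPair {d j l : ℕ} {c : ℝ} (hd : 1 ≤ d) (hjd : j ≤ d) (hld : l ≤ d)
    {F G : MvPolynomial (Fin 2) K} (hF : F.IsHomogeneous d) (hG : G.IsHomogeneous d)
    (DF : Dominant (dehom F) j c) (DG : Dominant (dehom G) l c)
    (h1 : 2 * j ≤ d + 1 ∨ 2 * l + 1 ≤ d) (h2 : d + 1 ≤ 2 * j ∨ d ≤ 2 * l + 1)
    (M : GL (Fin 2) K) :
    ‖(M : Matrix (Fin 2) (Fin 2) K).det‖ ^ (d - 1) * c ^ 2 ≤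
      maxNorm K d (conjPair K M F G).1 (conjPair K M F G).2 ^ 2 := by
  obtain ⟨⟨i₀, k₀⟩, -, hmax⟩ := Finset.exists_max_image (Finset.univ : Finset (Fin 2 × Fin 2))
    (fun x => ‖M x.1 x.2‖) Finset.univ_nonempty
  have hM : ∀ i k, ‖M i k‖ ≤ ‖M i₀ k₀‖ := fun i k => hmax (i, k) (Finset.mem_univ _)
  fin_cases i₀
  · have hc := conjPair_isHomogeneous swapGL hF hG
    have key := le_sq_maxNorm_conjPair_of_row (j := d - l) (l := d - j) hd (Nat.sub_le _ _)
      (Nat.sub_le _ _) hc.1 hc.2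
      (by rw [conjPair_swapGL]; exact DG.mobius_swap hld hG)
      (by rw [conjPair_swapGL]; exact DF.mobius_swap hjd hF) (by omega) (swapGL * M) k₀ (by
        intro i k
        fin_cases i
        · simpa [swapGL, Matrix.mul_apply] using hM 1 k
        · simpa [swapGL, Matrix.mul_apply] using hM 0 k)
    rw [← conjPair_mul, ← mul_assoc, swapGL_mul_swapGL, one_mul, Units.val_mul,
      Matrix.det_mul] at key
    simpa [swapGL] using key
  · exact le_sq_maxNorm_conjPair_of_row hd hjd hld hF hG DF DG h1 M k₀ hM

end LowerBound

section MinimalResultant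

variable {K}

lemma maxNorm_eq_of_dominant {d j l : ℕ} {c : ℝ} (hjd : j ≤ d)
    {F G : MvPolynomial (Fin 2) K} (hF : F.IsHomogeneous d) (hG : G.IsHomogeneous d)
    (DF : Dominant (dehom F) j c) (DG : Dominant (dehom G) l c) : maxNorm K d F G = c := by
  refine le_antisymm ?_ ?_
  · rw [maxNorm_le_iff hF hG]
    exact fun i _ => ⟨DF.norm_coeff_le i, DG.norm_coeff_le i⟩
  · rw [← DF.1]
    exact (norm_coeff_dehom_le_maxNorm hF hG hjd).1

lemma log_norm_bres_conjPair [IsAlgClosed K] {d : ℕ} (M : GL (Fin 2) K)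
    {F G : MvPolynomial (Fin 2) K} (hF : F.IsHomogeneous d) (hG : G.IsHomogeneous d)
    (h0 : bres d F G ≠ 0) :
    bres d (conjPair K M F G).1 (conjPair K M F G).2 ≠ 0 ∧
    Real.log ‖bres d (conjPair K M F G).1 (conjPair K M F G).2‖ =
      (d * d - d) * Real.log ‖(M : Matrix (Fin 2) (Fin 2) K).det‖ + Real.log ‖bres d F G‖ := by
  have hdet := ((Matrix.isUnit_iff_isUnit_det _).mp M.isUnit).ne_zero
  have h := norm_bres_conjPair M hF hG
  have hδ : ‖(M : Matrix (Fin 2) (Fin 2) K).det‖ ≠ 0 := norm_ne_zero_iff.mpr hdet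
  have hb : ‖bres d F G‖ ≠ 0 := norm_ne_zero_iff.mpr h0
  have hb' : ‖bres d (conjPair K M F G).1 (conjPair K M F G).2‖ ≠ 0 := by
    intro h1
    rw [h1, zero_mul] at h
    exact mul_ne_zero (pow_ne_zero _ hδ) hb h.symm
  refine ⟨norm_ne_zero_iff.mp hb', ?_⟩
  have h2 := congrArg Real.log h
  rw [Real.log_mul hb' (pow_ne_zero _ hδ), Real.log_mul (pow_ne_zero _ hδ) hb, Real.log_pow,
    Real.log_pow] at h2
  push_cast at h2
  linarith

/-- The minimal resultant is attained at a conjugate whose dominant coefficients are in stable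
position. -/
theorem Rmin_eq_of_dominant [IsAlgClosed K] {d j l : ℕ} {c : ℝ} (hd : 1 ≤ d) (hjd : j ≤ d)
    (hld : l ≤ d) {F G : MvPolynomial (Fin 2) K} (hF : F.IsHomogeneous d)
    (hG : G.IsHomogeneous d) (h0 : bres d F G ≠ 0) (N : GL (Fin 2) K)
    (DF : Dominant (dehom (conjPair K N F G).1) j c)
    (DG : Dominant (dehom (conjPair K N F G).2) l c)
    (h1 : 2 * j ≤ d + 1 ∨ 2 * l + 1 ≤ d) (h2 : d + 1 ≤ 2 * j ∨ d ≤ 2 * l + 1) :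
    Rmin K d F G = ordv K (bres d F G) -
      (d * d - d) * Real.log ‖(N : Matrix (Fin 2) (Fin 2) K).det‖ + 2 * d * Real.log c := by
  have hN := conjPair_isHomogeneous N hF hG
  obtain ⟨hb0, hb⟩ := log_norm_bres_conjPair N hF hG h0
  have hval : Rpair K d (conjPair K N F G).1 (conjPair K N F G).2 = ordv K (bres d F G) -
      (d * d - d) * Real.log ‖(N : Matrix (Fin 2) (Fin 2) K).det‖ + 2 * d * Real.log c := by
    rw [Rpair, maxNorm_eq_of_dominant hjd hN.1 hN.2 DF DG, ordv, ordv, hb]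
    ring
  rw [Rmin, iInf]
  refine IsLeast.csInf_eq ⟨⟨N, hval⟩, ?_⟩
  rintro _ ⟨M, rfl⟩
  dsimp only
  obtain ⟨T, rfl⟩ : ∃ T, M = N * T := ⟨N⁻¹ * M, by simp⟩
  rw [← hval, conjPair_mul]
  have hlow := le_sq_maxNorm_conjPair hd hjd hld hN.1 hN.2 DF DG h1 h2 T
  obtain ⟨-, hT⟩ := log_norm_bres_conjPair T hN.1 hN.2 hb0
  have hδ : 0 < ‖(T : Matrix (Fin 2) (Fin 2) K).det‖ :=
    norm_pos_iff.mpr ((Matrix.isUnit_iff_isUnit_det _).mp T.isUnit).ne_zero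
  have hlog := Real.log_le_log (mul_pos (pow_pos hδ _) (pow_pos DF.pos 2)) hlow
  rw [Real.log_mul (pow_pos hδ _).ne' (pow_pos DF.pos 2).ne', Real.log_pow, Real.log_pow,
    Real.log_pow, Nat.cast_sub hd] at hlog
  push_cast at hlog
  rw [Rpair, Rpair, maxNorm_eq_of_dominant hjd hN.1 hN.2 DF DG, ordv, ordv, hT]
  have := mul_le_mul_of_nonneg_left hlog (Nat.cast_nonneg (α := ℝ) d)
  linarith

end MinimalResultant

section TateSeries

variable {K}

lemma norm_div_one_sub_sq {ρ r : ℝ} (h0 : 0 < ρ) (h1 : ρ < 1) (hr : r ≠ 0) {u : K}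
    (hu : ‖u‖ = ρ ^ r) : ‖u / (1 - u) ^ 2‖ = ρ ^ |r| := by
  have hn1 : ‖(1 : K)‖ = 1 := norm_one
  rw [norm_div, norm_pow, sub_eq_add_neg]
  rcases hr.lt_or_gt with hr | hr
  · have hlt : 1 < ρ ^ r := Real.one_lt_rpow_of_pos_of_lt_one_of_neg h0 h1 hr
    rw [add_comm, norm_add_eq_of_lt (c := ρ ^ r) (by rw [norm_neg, hu]) (by rwa [hn1]), hu,
      abs_of_neg hr, Real.rpow_neg h0.le]
    have := (Real.rpow_pos_of_pos h0 r).ne'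
    field_simp
  · have hlt : ρ ^ r < 1 := Real.rpow_lt_one h0.le h1 hr
    rw [norm_add_eq_of_lt hn1 (by rwa [norm_neg, hu]), hu, abs_of_pos hr]
    simp

lemma norm_add_le_of_norm_le {x y : K} {c : ℝ} (hx : ‖x‖ ≤ c) (hy : ‖y‖ ≤ c) : ‖x + y‖ ≤ c :=
  (IsUltrametricDist.norm_add_le_max x y).trans (max_le hx hy)

lemma norm_q_pow_mul {q w : K} (hq0 : q ≠ 0) {s : ℝ} (hw : ‖w‖ = ‖q‖ ^ s) (n : ℕ) :
    ‖q ^ n * w‖ = ‖q‖ ^ ((n : ℝ) + s) ∧ ‖q ^ n * w⁻¹‖ = ‖q‖ ^ ((n : ℝ) - s) := by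
  have h := norm_pos_iff.mpr hq0
  refine ⟨?_, ?_⟩
  · rw [norm_mul, norm_pow, hw, Real.rpow_add h, Real.rpow_natCast]
  · rw [norm_mul, norm_pow, norm_inv, hw, Real.rpow_sub h, Real.rpow_natCast, div_eq_mul_inv]

lemma norm_two_mul_le (x : K) : ‖2 * x‖ ≤ ‖x‖ := by
  have h2 : ‖(2 : K)‖ ≤ 1 := by
    simpa using IsUltrametricDist.norm_natCast_le_one K 2
  rw [norm_mul]
  exact mul_le_of_le_one_left (norm_nonneg x) h2

lemma norm_tateTerm_parts {q w : K} (hq0 : q ≠ 0) (hq1 : ‖q‖ < 1) {s : ℝ} (hs : 0 < s)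
    (hw : ‖w‖ = ‖q‖ ^ s) {n : ℕ} (hn : n ≠ 0) (hsn : s ≠ n) :
    ‖q ^ n * w / (1 - q ^ n * w) ^ 2‖ = ‖q‖ ^ ((n : ℝ) + s) ∧
    ‖q ^ n * w⁻¹ / (1 - q ^ n * w⁻¹) ^ 2‖ = ‖q‖ ^ |s - n| ∧
    ‖2 * (q ^ n / (1 - q ^ n) ^ 2)‖ ≤ ‖q‖ ^ (n : ℝ) := by
  have h := norm_pos_iff.mpr hq0
  have hn' : (0 : ℝ) < n := by positivity
  obtain ⟨h1, h2⟩ := norm_q_pow_mul hq0 hw n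
  refine ⟨?_, ?_, (norm_two_mul_le _).trans ?_⟩
  · rw [norm_div_one_sub_sq h hq1 (by positivity) h1, abs_of_pos (by positivity)]
  · rw [norm_div_one_sub_sq h hq1 (sub_ne_zero.mpr hsn.symm) h2, abs_sub_comm]
  · rw [norm_div_one_sub_sq h hq1 hn'.ne' (by rw [norm_pow, Real.rpow_natCast]),
      abs_of_pos hn']

lemma norm_tateTerm_le {q w : K} (hq0 : q ≠ 0) (hq1 : ‖q‖ < 1) {s : ℝ} (hs : 0 < s)
    (hw : ‖w‖ = ‖q‖ ^ s) {n : ℕ} (hn : n ≠ 0) (hsn : s ≠ n) {r : ℝ} (hr : r ≤ n)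
    (hr' : r ≤ |s - n|) : ‖tateTerm K q w n‖ ≤ ‖q‖ ^ r := by
  have h := norm_pos_iff.mpr hq0
  obtain ⟨h1, h2, h3⟩ := norm_tateTerm_parts hq0 hq1 hs hw hn hsn
  have mono : ∀ {x : ℝ}, r ≤ x → ‖q‖ ^ x ≤ ‖q‖ ^ r := fun hx =>
    Real.rpow_le_rpow_of_exponent_ge h hq1.le hx
  rw [tateTerm, sub_eq_add_neg]
  refine norm_add_le_of_norm_le (norm_add_le_of_norm_le (h1.trans_le (mono (by linarith))) (h2.trans_le (mono hr'))) ?_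
  rw [norm_neg]
  exact h3.trans (mono hr)

lemma summable_tateTerm [CompleteSpace K] {q w : K} (hq0 : q ≠ 0) (hq1 : ‖q‖ < 1) {s : ℝ}
    (hs : 0 < s) (hw : ‖w‖ = ‖q‖ ^ s) (hsn : ∀ n : ℕ, s ≠ n) :
    Summable fun n : ℕ => tateTerm K q w (n + 1) := by
  have h := norm_pos_iff.mpr hq0
  refine NonarchimedeanAddGroup.summable_of_tendsto_cofinite_zero ?_
  rw [Nat.cofinite_eq_atTop, tendsto_zero_iff_norm_tendsto_zero]
  refine squeeze_zero (g := fun n : ℕ => ‖q‖ ^ n * ‖q‖ ^ (1 - s)) (fun _ => norm_nonneg _)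
    (fun n => ?_) ?_
  · rw [← Real.rpow_natCast, ← Real.rpow_add h]
    refine norm_tateTerm_le hq0 hq1 hs hw n.succ_ne_zero (hsn _) ?_ ?_
    · push_cast; linarith
    · rw [abs_sub_comm]
      refine le_trans (le_of_eq ?_) (le_abs_self _)
      push_cast; ring
  · simpa using (tendsto_pow_atTop_nhds_zero_of_lt_one (norm_nonneg q) hq1).mul_const
      (‖q‖ ^ (1 - s))

lemma norm_xTate_of_abs_sub_lt [CompleteSpace K] {q w : K} (hq0 : q ≠ 0) (hq1 : ‖q‖ < 1) {s : ℝ}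
    (hs : 0 < s) (hw : ‖w‖ = ‖q‖ ^ s) (hsn : ∀ n : ℕ, s ≠ n) {n₀ : ℕ} (hn₀ : |s - n₀| < 1 / 2) :
    ‖xTate K q w‖ = ‖q‖ ^ |s - n₀| := by
  have h := norm_pos_iff.mpr hq0
  set δ := |s - n₀| with hδ
  have hfar : ∀ n : ℕ, n ≠ n₀ → 1 - δ ≤ |s - n| := by
    intro n hn
    have h1 : (1 : ℝ) ≤ |(n : ℝ) - n₀| := by
      have : (1 : ℤ) ≤ |(n : ℤ) - n₀| := Int.one_le_abs (by omega)
      exact_mod_cast this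
    have h2 := abs_sub_abs_le_abs_sub ((n : ℝ) - n₀) (s - n₀)
    have h3 : ((n : ℝ) - n₀) - (s - n₀) = -(s - n) := by ring
    rw [h3, abs_neg] at h2
    linarith
  have hlt : ‖q‖ ^ (1 - δ) < ‖q‖ ^ δ :=
    Real.rpow_lt_rpow_of_exponent_gt h hq1 (by linarith)
  have hδ0 : 0 ≤ δ := abs_nonneg _
  have mono : ∀ {x : ℝ}, 1 - δ ≤ x → ‖q‖ ^ x ≤ ‖q‖ ^ (1 - δ) := fun hx =>
    Real.rpow_le_rpow_of_exponent_ge h hq1.le hx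
  have hn1 : ∀ n : ℕ, 1 - δ ≤ ((n + 1 : ℕ) : ℝ) := by
    intro n; push_cast; have : (0 : ℝ) ≤ n := n.cast_nonneg; linarith
  have hterm : ∀ n : ℕ, n + 1 ≠ n₀ → ‖tateTerm K q w (n + 1)‖ ≤ ‖q‖ ^ (1 - δ) := fun n hn =>
    norm_tateTerm_le hq0 hq1 hs hw n.succ_ne_zero (hsn _) (hn1 n) (hfar _ hn)
  have hpos : 0 ≤ ‖q‖ ^ (1 - δ) := by positivity
  have h00 := norm_div_one_sub_sq h hq1 hs.ne' hw
  rw [xTate]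
  rcases Nat.eq_zero_or_pos n₀ with h0 | h0
  · refine norm_add_eq_of_lt (by rw [h00, hδ, h0]; simp) (lt_of_le_of_lt ?_ hlt)
    exact IsUltrametricDist.norm_tsum_le_of_forall_le_of_nonneg hpos
      fun n => hterm n (by omega)
  · obtain ⟨n₁, rfl⟩ : ∃ n, n₀ = n + 1 := ⟨n₀ - 1, by omega⟩
    rw [(summable_tateTerm hq0 hq1 hs hw hsn).tsum_eq_add_tsum_ite n₁]
    obtain ⟨h1, h2, h3⟩ := norm_tateTerm_parts hq0 hq1 hs hw n₁.succ_ne_zero (hsn _)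
    have hr : ‖∑' n, (if n = n₁ then 0 else tateTerm K q w (n + 1))‖ ≤ ‖q‖ ^ (1 - δ) := by
      refine IsUltrametricDist.norm_tsum_le_of_forall_le_of_nonneg hpos fun n => ?_
      split_ifs with hn
      · simpa using hpos
      · exact hterm n (by omega)
    have h0' : ‖w / (1 - w) ^ 2‖ ≤ ‖q‖ ^ (1 - δ) := by
      rw [h00]
      refine mono ?_
      simpa using hfar 0 (by omega)
    have hre : ∀ a b c d e : K, a + (b + c - d + e) = c + (a + b + -d + e) := by intros; ring
    rw [tateTerm, hre]
    refine norm_add_eq_of_lt h2 (lt_of_le_of_lt ?_ hlt)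
    refine norm_add_le_of_norm_le (norm_add_le_of_norm_le (norm_add_le_of_norm_le h0' (h1.trans_le (mono ?_))) ?_) hr
    · linarith [hn1 n₁]
    · rw [norm_neg]
      exact h3.trans (mono (hn1 n₁))

/-- Valuation of Tate's series: distance from the valuation of `w` to the nearest integer. -/
lemma norm_xTate [CompleteSpace K] {q w : K} (hq0 : q ≠ 0) (hq1 : ‖q‖ < 1) {s : ℝ}
    (hs : 0 < s) (hw : ‖w‖ = ‖q‖ ^ s) (hsn : ∀ n : ℤ, 2 * s ≠ n) :
    ‖xTate K q w‖ = ‖q‖ ^ ‖(s : UnitAddCircle)‖ := by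
  have hround : (0 : ℤ) ≤ round s := by
    rw [round_eq]
    exact Int.floor_nonneg.mpr (by linarith)
  obtain ⟨n₀, hn₀⟩ := Int.eq_ofNat_of_zero_le hround
  have hcast : ((round s : ℤ) : ℝ) = n₀ := by rw [hn₀]; simp
  rw [UnitAddCircle.norm_eq, hcast]
  refine norm_xTate_of_abs_sub_lt hq0 hq1 hs hw (fun n hn => hsn (2 * n) ?_) ?_
  · rw [hn]; push_cast; ring
  · have h1 := abs_sub_round s
    rw [hcast] at h1
    refine lt_of_le_of_ne h1 fun h2 => ?_
    rcases abs_eq (by norm_num : (0 : ℝ) ≤ 1 / 2) |>.mp h2 with h3 | h3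
    · refine hsn (2 * n₀ + 1) ?_
      push_cast; linarith
    · refine hsn (2 * n₀ - 1) ?_
      push_cast; linarith

lemma exists_norm_eq_rpow [IsAlgClosed K] {q : K} (hq0 : q ≠ 0) (t : ℚ) :
    ∃ w : K, w ≠ 0 ∧ ‖w‖ = ‖q‖ ^ (t : ℝ) := by
  have h := norm_pos_iff.mpr hq0
  obtain ⟨w, hw⟩ := IsAlgClosed.exists_pow_nat_eq (q ^ t.num) t.den_pos
  have hn : ‖w‖ = ‖q‖ ^ (t : ℝ) := by
    have h1 : ‖w‖ ^ t.den = (‖q‖ ^ (t : ℝ)) ^ t.den := by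
      rw [← norm_pow, hw, norm_zpow, ← Real.rpow_natCast (‖q‖ ^ (t : ℝ)), ← Real.rpow_mul h.le,
        ← Real.rpow_intCast]
      congr 1
      exact_mod_cast (Rat.mul_den_eq_num t).symm
    exact (pow_left_inj₀ (norm_nonneg _) (by positivity) t.den_nz).mp h1
  refine ⟨w, ?_, hn⟩
  rw [← norm_pos_iff, hn]
  positivity

end TateSeries

section MinSum

/-- The sum of `min a t` over a multiset: the concave piecewise linear function with
breakpoints `A`. -/
def minSum (A : Multiset ℝ) (t : ℝ) : ℝ := (A.map fun a => min a t).sum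

lemma eq_zero_of_sum_map_nonpos {A : Multiset ℝ} {φ : ℝ → ℝ} (h : ∀ a ∈ A, 0 ≤ φ a)
    (hs : (A.map φ).sum ≤ 0) : ∀ a ∈ A, φ a = 0 := by
  intro a ha
  refine le_antisymm (le_trans ?_ hs) (h a ha)
  refine Multiset.single_le_sum (fun x hx => ?_) _ (Multiset.mem_map_of_mem φ ha)
  obtain ⟨b, hb, rfl⟩ := Multiset.mem_map.mp hx
  exact h b hb

lemma sum_map_nonneg {A : Multiset ℝ} {φ : ℝ → ℝ} (h : ∀ a ∈ A, 0 ≤ φ a) :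
    0 ≤ (A.map φ).sum := by
  refine Multiset.sum_nonneg fun x hx => ?_
  obtain ⟨b, hb, rfl⟩ := Multiset.mem_map.mp hx
  exact h b hb

lemma minSum_concave_defect (A : Multiset ℝ) (x y z : ℝ) :
    2 * minSum A y - minSum A x - minSum A z =
      (A.map fun a => 2 * min a y - min a x - min a z).sum := by
  simp only [minSum, Multiset.sum_map_sub, Multiset.sum_map_mul_left]

lemma minSum_sub (A : Multiset ℝ) (x y : ℝ) :
    minSum A y - minSum A x = (A.map fun a => min a y - min a x).sum := by
  simp only [minSum, Multiset.sum_map_sub]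

lemma min_concave_defect_nonneg (a x δ : ℝ) (hδ : 0 ≤ δ) :
    0 ≤ 2 * min a (x + δ) - min a x - min a (x + 2 * δ) := by
  rcases le_total a x with h | h <;> rcases le_total a (x + δ) with h1 | h1 <;>
    rcases le_total a (x + 2 * δ) with h2 | h2 <;>
    simp only [min_eq_left, min_eq_right, h, h1, h2] <;> linarith

lemma eq_or_of_min_concave_defect_eq_zero {a x δ : ℝ}
    (h0 : 2 * min a (x + δ) - min a x - min a (x + 2 * δ) = 0) : a ≤ x ∨ x + 2 * δ ≤ a := by
  by_contra! hc
  rw [min_eq_right hc.1.le, min_eq_left hc.2.le] at h0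
  rcases le_total a (x + δ) with h1 | h1
  · rw [min_eq_left h1] at h0; linarith
  · rw [min_eq_right h1] at h0; linarith

variable {m : ℕ}

/-- The grid points `k / (2 * m)`. -/
def gridPt (m k : ℕ) : ℝ := (k : ℝ) / (2 * m)

lemma gridPt_succ (m k : ℕ) : gridPt m (k + 1) = gridPt m k + 1 / (2 * m) := by
  simp only [gridPt]; push_cast; ring

lemma gridPt_add_two (m k : ℕ) : gridPt m (k + 2) = gridPt m k + 2 * (1 / (2 * m)) := by
  simp only [gridPt]; push_cast; ring

lemma gridPt_mono (m : ℕ) : Monotone (gridPt m) := by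
  intro a b h
  simp only [gridPt]
  gcongr

lemma gridPt_self (hm : m ≠ 0) : gridPt m m = 1 / 2 := by
  have : (m : ℝ) ≠ 0 := by exact_mod_cast hm
  simp only [gridPt]; field_simp

lemma gridPt_zero (m : ℕ) : gridPt m 0 = 0 := by simp [gridPt]

lemma gridPt_one (m : ℕ) : gridPt m 1 = 1 / (2 * m) := by simp [gridPt]

/-- The increment of `minSum` over the `k`-th grid cell. -/
def gridInc (m : ℕ) (A : Multiset ℝ) (k : ℕ) : ℝ :=
  minSum A (gridPt m (k + 1)) - minSum A (gridPt m k)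

lemma gridInc_sub_gridInc_succ (A : Multiset ℝ) (k : ℕ) :
    gridInc m A k - gridInc m A (k + 1) =
      (A.map fun a => 2 * min a (gridPt m k + 1 / (2 * m)) - min a (gridPt m k) -
        min a (gridPt m k + 2 * (1 / (2 * m)))).sum := by
  rw [← minSum_concave_defect, ← gridPt_succ, ← gridPt_add_two, gridInc, gridInc]
  ring

lemma gridInc_succ_le (A : Multiset ℝ) (k : ℕ) : gridInc m A (k + 1) ≤ gridInc m A k := by
  rw [← sub_nonneg, gridInc_sub_gridInc_succ]
  exact sum_map_nonneg fun a _ => min_concave_defect_nonneg _ _ _ (by positivity)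

lemma avoid_of_gridInc_eq (hm : m ≠ 0) {A : Multiset ℝ} {k : ℕ}
    (h : gridInc m A (k + 1) = gridInc m A k) :
    ∀ a ∈ A, a ≤ gridPt m k ∨ gridPt m (k + 2) ≤ a := by
  have h0 : gridInc m A k - gridInc m A (k + 1) ≤ 0 := by rw [h, sub_self]
  rw [gridInc_sub_gridInc_succ] at h0
  intro a ha
  rw [gridPt_add_two]
  have hm' : (0 : ℝ) < m := by positivity
  exact eq_or_of_min_concave_defect_eq_zero (eq_zero_of_sum_map_nonpos
      (fun a _ => min_concave_defect_nonneg a (gridPt m k) _ (by positivity)) h0 a ha)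

lemma gridInc_eq_sum (A : Multiset ℝ) (k : ℕ) :
    gridInc m A k = (A.map fun a => min a (gridPt m (k + 1)) - min a (gridPt m k)).sum := by
  rw [gridInc, minSum_sub]

lemma gridInc_nonneg (A : Multiset ℝ) (k : ℕ) : 0 ≤ gridInc m A k := by
  rw [gridInc_eq_sum]
  refine sum_map_nonneg fun a _ => sub_nonneg.mpr ?_
  exact min_le_min_left _ (gridPt_mono m k.le_succ)

lemma le_of_gridInc_eq_zero (hm : m ≠ 0) {A : Multiset ℝ} {k : ℕ} (h : gridInc m A k = 0) :
    ∀ a ∈ A, a ≤ gridPt m k := by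
  rw [gridInc_eq_sum] at h
  intro a ha
  have h0 := eq_zero_of_sum_map_nonpos (fun a _ => sub_nonneg.mpr
    (min_le_min_left a (gridPt_mono m k.le_succ))) h.le a ha
  by_contra! hc
  rw [min_eq_right hc.le, gridPt_succ] at h0
  have hm' : (0 : ℝ) < m := by positivity
  have : gridPt m k < min a (gridPt m k + 1 / (2 * m)) :=
    lt_min hc (lt_add_of_pos_right _ (by positivity))
  linarith

lemma sum_sub_gridInc_zero (A : Multiset ℝ) :
    (A.card : ℝ) * (1 / (2 * m)) - gridInc m A 0 =
      (A.map fun a => 1 / (2 * m) - (min a (gridPt m 1) - min a (gridPt m 0))).sum := by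
  rw [gridInc_eq_sum, Multiset.sum_map_sub]
  simp

lemma cell_zero_nonneg (m : ℕ) (a : ℝ) :
    0 ≤ 1 / (2 * m) - (min a (gridPt m 1) - min a (gridPt m 0)) := by
  have hm' : (0 : ℝ) ≤ 1 / (2 * m) := by positivity
  rw [gridPt_one, gridPt_zero]
  rcases le_total a 0 with h | h <;> rcases le_total a (1 / (2 * m)) with h2 | h2 <;>
    simp only [min_eq_left, min_eq_right, h, h2] <;> linarith

lemma gridInc_zero_le (A : Multiset ℝ) : gridInc m A 0 ≤ (A.card : ℝ) * (1 / (2 * m)) := by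
  rw [← sub_nonneg, sum_sub_gridInc_zero]
  exact sum_map_nonneg fun a _ => cell_zero_nonneg m a

lemma le_of_gridInc_zero_eq (hm : m ≠ 0) {A : Multiset ℝ}
    (h : gridInc m A 0 = (A.card : ℝ) * (1 / (2 * m))) : ∀ a ∈ A, gridPt m 1 ≤ a := by
  have h0 : (A.card : ℝ) * (1 / (2 * m)) - gridInc m A 0 ≤ 0 := by rw [h, sub_self]
  rw [sum_sub_gridInc_zero] at h0
  intro a ha
  have h1 := eq_zero_of_sum_map_nonpos (fun a _ => cell_zero_nonneg m a) h0 a ha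
  have hm' : (0 : ℝ) < 1 / (2 * m) := by positivity
  rw [gridPt_one, gridPt_zero] at h1
  by_contra! hc
  rw [gridPt_one] at hc
  rw [min_eq_left hc.le] at h1
  rcases le_total a 0 with h | h
  · rw [min_eq_left h] at h1; linarith
  · rw [min_eq_right h] at h1; linarith

/-- Data of two multisets of breakpoints whose `minSum`s differ, up to a constant, by half the
parity at each grid point. -/
structure GridData (m : ℕ) (A B : Multiset ℝ) (a₀ b₀ : ℝ) : Prop where
  two_le : 2 ≤ m
  card_le : A.card ≤ m ^ 2
  eq_add : ∀ k ≤ m, a₀ + minSum A (gridPt m k) = b₀ + minSum B (gridPt m k) + ((k % 2 : ℕ) : ℝ) / 2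

namespace GridData

variable {A B : Multiset ℝ} {a₀ b₀ : ℝ}

lemma gridInc_sub (H : GridData m A B a₀ b₀) {k : ℕ} (hk : k < m) :
    gridInc m A k = gridInc m B k + (((k + 1) % 2 : ℕ) : ℝ) / 2 - ((k % 2 : ℕ) : ℝ) / 2 := by
  have h1 := H.eq_add (k + 1) hk
  have h2 := H.eq_add k hk.le
  rw [gridInc, gridInc]
  linarith

lemma ne_zero (H : GridData m A B a₀ b₀) : m ≠ 0 := by
  have := H.two_le
  omega

lemma defect_mono (H : GridData m A B a₀ b₀) {k : ℕ} (hk : k + 1 < m) :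
    gridInc m A (k + 1) + (((k + 2) / 2 : ℕ) : ℝ) ≤ gridInc m A k + (((k + 1) / 2 : ℕ) : ℝ) := by
  rcases Nat.even_or_odd' k with ⟨i, rfl | rfl⟩
  · have h1 := H.gridInc_sub (k := 2 * i) (by omega)
    have h2 := H.gridInc_sub hk
    have h3 := gridInc_succ_le (m := m) B (2 * i)
    rw [show (2 * i + 1 + 1) % 2 = 0 by omega, show (2 * i + 1) % 2 = 1 by omega] at h2
    rw [show (2 * i) % 2 = 0 by omega, show (2 * i + 1) % 2 = 1 by omega] at h1
    rw [show (2 * i + 2) / 2 = i + 1 by omega, show (2 * i + 1) / 2 = i by omega]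
    push_cast at *
    linarith
  · have h3 := gridInc_succ_le (m := m) A (2 * i + 1)
    rw [show (2 * i + 1 + 2) / 2 = i + 1 by omega, show (2 * i + 1 + 1) / 2 = i + 1 by omega]
    linarith

lemma gridInc_zero_le_half (H : GridData m A B a₀ b₀) : gridInc m A 0 ≤ (m : ℝ) / 2 := by
  have hm : (0 : ℝ) < m := by have := H.ne_zero; positivity
  have hc : (A.card : ℝ) ≤ (m : ℝ) ^ 2 := by exact_mod_cast H.card_le
  calc _ ≤ (A.card : ℝ) * (1 / (2 * m)) := gridInc_zero_le A
    _ ≤ (m : ℝ) ^ 2 * (1 / (2 * m)) := by gcongr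
    _ = m / 2 := by field_simp

lemma defect_antitone (H : GridData m A B a₀ b₀) {i k : ℕ} (hik : i ≤ k) (hk : k < m) :
    gridInc m A k + (((k + 1) / 2 : ℕ) : ℝ) ≤ gridInc m A i + (((i + 1) / 2 : ℕ) : ℝ) := by
  induction k, hik using Nat.le_induction with
  | base => exact le_rfl
  | succ k hik ih => exact (H.defect_mono hk).trans (ih (by omega))

lemma le_last (H : GridData m A B a₀ b₀) :
    (m : ℝ) / 2 ≤ gridInc m A (m - 1) + (((m - 1 + 1) / 2 : ℕ) : ℝ) := by
  obtain ⟨n, rfl⟩ : ∃ n, m = n + 1 := ⟨m - 1, by have := H.ne_zero; omega⟩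
  have h := H.gridInc_sub (k := n) (by omega)
  have hA := gridInc_nonneg (m := n + 1) A n
  have hB := gridInc_nonneg (m := n + 1) B n
  rw [Nat.add_sub_cancel]
  rcases Nat.even_or_odd' n with ⟨i, rfl | rfl⟩
  · rw [show (2 * i) % 2 = 0 by omega, show (2 * i + 1) % 2 = 1 by omega] at h
    rw [show (2 * i + 1) / 2 = i by omega]
    push_cast at *
    linarith
  · rw [show (2 * i + 1 + 1) / 2 = i + 1 by omega]
    push_cast at *
    linarith

lemma gridInc_left (H : GridData m A B a₀ b₀) {k : ℕ} (hk : k < m) :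
    gridInc m A k = (m : ℝ) / 2 - (((k + 1) / 2 : ℕ) : ℝ) := by
  have h1 := H.defect_antitone (Nat.zero_le k) hk
  have h2 := H.defect_antitone (i := k) (k := m - 1) (by omega) (by omega)
  have h3 := H.le_last
  have h4 := H.gridInc_zero_le_half
  simp only [zero_add, Nat.reduceDiv, Nat.cast_zero, add_zero] at h1
  linarith

lemma gridInc_right (H : GridData m A B a₀ b₀) {k : ℕ} (hk : k < m) :
    gridInc m B k = ((m : ℝ) - 1) / 2 - ((k / 2 : ℕ) : ℝ) := by
  have h := H.gridInc_sub hk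
  rw [H.gridInc_left hk] at h
  rcases Nat.even_or_odd' k with ⟨i, rfl | rfl⟩
  · rw [show (2 * i) % 2 = 0 by omega, show (2 * i + 1) % 2 = 1 by omega,
      show (2 * i + 1) / 2 = i by omega] at h
    rw [show 2 * i / 2 = i by omega]
    push_cast at *
    linarith
  · rw [show (2 * i + 1) % 2 = 1 by omega, show (2 * i + 1 + 1) % 2 = 0 by omega,
      show (2 * i + 1 + 1) / 2 = i + 1 by omega] at h
    rw [show (2 * i + 1) / 2 = i by omega]
    push_cast at *
    linarith

lemma card_left (H : GridData m A B a₀ b₀) : A.card = m ^ 2 := by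
  have hm : (0 : ℝ) < m := by have := H.ne_zero; positivity
  refine le_antisymm H.card_le ?_
  have h := gridInc_zero_le (m := m) A
  rw [H.gridInc_left (by have := H.ne_zero; omega)] at h
  simp only [zero_add, Nat.reduceDiv, Nat.cast_zero, sub_zero] at h
  have h2 : (m : ℝ) ^ 2 ≤ A.card := by
    have := mul_le_mul_of_nonneg_right h (by positivity : (0 : ℝ) ≤ 2 * m)
    field_simp at this
    linarith
  exact_mod_cast h2

lemma gridPt_one_le (H : GridData m A B a₀ b₀) : ∀ a ∈ A, gridPt m 1 ≤ a := by
  have hm : (0 : ℝ) < m := by have := H.ne_zero; positivity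
  refine le_of_gridInc_zero_eq H.ne_zero ?_
  rw [H.gridInc_left (by have := H.ne_zero; omega), H.card_left]
  push_cast
  rw [sub_zero]
  field_simp

lemma avoid_left (H : GridData m A B a₀ b₀) {k : ℕ} (hk : k % 2 = 1) (hkm : k + 1 < m) :
    ∀ a ∈ A, a ≤ gridPt m k ∨ gridPt m (k + 2) ≤ a := by
  refine avoid_of_gridInc_eq H.ne_zero ?_
  rw [H.gridInc_left hkm, H.gridInc_left (by omega), show (k + 1 + 1) / 2 = (k + 1) / 2 by omega]

lemma avoid_right (H : GridData m A B a₀ b₀) {k : ℕ} (hk : k % 2 = 0) (hkm : k + 1 < m) :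
    ∀ b ∈ B, b ≤ gridPt m k ∨ gridPt m (k + 2) ≤ b := by
  refine avoid_of_gridInc_eq H.ne_zero ?_
  rw [H.gridInc_right hkm, H.gridInc_right (by omega), show (k + 1) / 2 = k / 2 by omega]

lemma le_left_of_even (H : GridData m A B a₀ b₀) (hm : m % 2 = 0) :
    ∀ a ∈ A, a ≤ gridPt m (m - 1) := by
  have h0 := H.ne_zero
  refine le_of_gridInc_eq_zero H.ne_zero ?_
  rw [H.gridInc_left (by omega)]
  obtain ⟨i, rfl⟩ : ∃ i, m = 2 * i := ⟨m / 2, by omega⟩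
  rw [show (2 * i - 1 + 1) / 2 = i by omega]
  push_cast
  ring

lemma le_right_of_odd (H : GridData m A B a₀ b₀) (hm : m % 2 = 1) :
    ∀ b ∈ B, b ≤ gridPt m (m - 1) := by
  refine le_of_gridInc_eq_zero H.ne_zero ?_
  rw [H.gridInc_right (by omega)]
  obtain ⟨i, rfl⟩ : ∃ i, m = 2 * i + 1 := ⟨m / 2, by omega⟩
  rw [show (2 * i + 1 - 1) / 2 = i by omega]
  push_cast
  ring

/-- No breakpoint of either multiset lies in the interior of a grid cell. -/
lemma cell_left (H : GridData m A B a₀ b₀) {k : ℕ} (hk : k < m) :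
    ∀ a ∈ A, a ≤ gridPt m k ∨ gridPt m (k + 1) ≤ a := by
  intro a ha
  rcases Nat.mod_two_eq_zero_or_one k with h | h
  · rcases Nat.eq_zero_or_pos k with rfl | h0
    · exact Or.inr (H.gridPt_one_le a ha)
    · obtain ⟨i, rfl⟩ : ∃ i, k = i + 1 := ⟨k - 1, by omega⟩
      exact (H.avoid_left (by omega) hk a ha).imp_left fun h => h.trans (gridPt_mono m i.le_succ)
  · rcases eq_or_lt_of_le (Nat.succ_le_of_lt hk) with h1 | h1
    · left
      have := H.le_left_of_even (by omega) a ha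
      rwa [show m - 1 = k by omega] at this
    · exact (H.avoid_left h h1 a ha).imp_right fun h => (gridPt_mono m (by omega)).trans h

lemma cell_right (H : GridData m A B a₀ b₀) {k : ℕ} (hk : k < m) :
    ∀ b ∈ B, b ≤ gridPt m k ∨ gridPt m (k + 1) ≤ b := by
  intro b hb
  rcases Nat.mod_two_eq_zero_or_one k with h | h
  · rcases eq_or_lt_of_le (Nat.succ_le_of_lt hk) with h1 | h1
    · left
      have := H.le_right_of_odd (by omega) b hb
      rwa [show m - 1 = k by omega] at this
    · exact (H.avoid_right h h1 b hb).imp_right fun h => (gridPt_mono m (by omega)).trans h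
  · obtain ⟨i, rfl⟩ : ∃ i, k = i + 1 := ⟨k - 1, by omega⟩
    exact (H.avoid_right (by omega) hk b hb).imp_left fun h => h.trans (gridPt_mono m i.le_succ)

lemma lt_half (H : GridData m A B a₀ b₀) : (∀ a ∈ A, a < 1 / 2) ∨ ∀ b ∈ B, b < 1 / 2 := by
  have hm : (0 : ℝ) < m := by have := H.ne_zero; positivity
  have hlt : gridPt m (m - 1) < 1 / 2 := by
    rw [← gridPt_self H.ne_zero, gridPt, gridPt]
    gcongr
    have := H.ne_zero
    omega
  rcases Nat.mod_two_eq_zero_or_one m with h | h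
  · exact Or.inl fun a ha => (H.le_left_of_even h a ha).trans_lt hlt
  · exact Or.inr fun b hb => (H.le_right_of_odd h b hb).trans_lt hlt

end GridData

end MinSum

section GridSums

variable {m : ℕ}

lemma min_sub_min_eq_of_avoid {c x y t : ℝ} (hc : c ≤ x ∨ y ≤ c) (hxt : x ≤ t) (hty : t ≤ y) :
    (min c t - min c x) * (y - x) = (t - x) * (min c y - min c x) := by
  rcases hc with h | h
  · rw [min_eq_left h, min_eq_left (h.trans hxt), min_eq_left (h.trans (hxt.trans hty))]
    ring
  · rw [min_eq_right h, min_eq_right (hty.trans h), min_eq_right ((hxt.trans hty).trans h)]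

lemma minSum_of_mem_cell (hm : m ≠ 0) {C : Multiset ℝ} {k : ℕ} {t : ℝ}
    (hC : ∀ c ∈ C, c ≤ gridPt m k ∨ gridPt m (k + 1) ≤ c)
    (h1 : gridPt m k ≤ t) (h2 : t ≤ gridPt m (k + 1)) :
    minSum C t - minSum C (gridPt m k) = 2 * m * gridInc m C k * (t - gridPt m k) := by
  have hm' : (0 : ℝ) < m := by positivity
  rw [minSum_sub, gridInc_eq_sum, mul_comm, ← Multiset.sum_map_mul_left,
    ← Multiset.sum_map_mul_left]
  refine congrArg _ (Multiset.map_congr rfl fun c hc => ?_)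
  have h := min_sub_min_eq_of_avoid (hC c hc) h1 h2
  rw [show gridPt m (k + 1) - gridPt m k = 1 / (2 * m) by rw [gridPt_succ]; ring] at h
  rw [mul_left_comm, ← h]
  field_simp

lemma countP_lt_of_mem_cell (hm : m ≠ 0) {C : Multiset ℝ} {k : ℕ} {t : ℝ}
    (hC : ∀ c ∈ C, c ≤ gridPt m k ∨ gridPt m (k + 1) ≤ c)
    (h1 : gridPt m k < t) (h2 : t < gridPt m (k + 1)) :
    (C.countP (t < ·) : ℝ) = 2 * m * gridInc m C k := by
  have hm' : (0 : ℝ) < m := by positivity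
  rw [gridInc_eq_sum]
  induction C using Multiset.induction_on with
  | empty => simp
  | cons c C ih =>
    rw [Multiset.map_cons, Multiset.sum_cons, mul_add,
      ← ih fun c hc => hC c (Multiset.mem_cons_of_mem hc)]
    rcases hC c (Multiset.mem_cons_self c C) with h | h
    · rw [Multiset.countP_cons_of_neg _ (by linarith), min_eq_left h,
        min_eq_left (h.trans (gridPt_mono m k.le_succ))]
      ring
    · rw [Multiset.countP_cons_of_pos _ (by linarith), min_eq_right h,
        min_eq_right ((gridPt_mono m k.le_succ).trans h), gridPt_succ]
      push_cast
      field_simp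
      ring

lemma minSum_min_sub (hm : m ≠ 0) {C : Multiset ℝ} {k : ℕ}
    (hC : ∀ c ∈ C, c ≤ gridPt m k ∨ gridPt m (k + 1) ≤ c) (a : ℝ) :
    minSum C (min a (gridPt m (k + 1))) - minSum C (min a (gridPt m k)) =
      2 * m * gridInc m C k * (min a (gridPt m (k + 1)) - min a (gridPt m k)) := by
  have hmono := gridPt_mono m k.le_succ
  rcases le_total a (gridPt m k) with h | h
  · rw [min_eq_left h, min_eq_left (h.trans hmono)]
    ring
  · rw [min_eq_right h]
    exact minSum_of_mem_cell hm hC (le_min h hmono) (min_le_right _ _)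

lemma minSum_min_half_sub_zero (hm : m ≠ 0) {C : Multiset ℝ}
    (hC : ∀ k < m, ∀ c ∈ C, c ≤ gridPt m k ∨ gridPt m (k + 1) ≤ c) {a : ℝ} (ha : 0 ≤ a) :
    minSum C (min a (1 / 2)) - minSum C 0 =
      ∑ k ∈ Finset.range m,
        2 * m * gridInc m C k * (min a (gridPt m (k + 1)) - min a (gridPt m k)) := by
  rw [← Finset.sum_congr rfl fun k hk => minSum_min_sub hm (hC k (Finset.mem_range.mp hk)) a,
    Finset.sum_range_sub (fun k => minSum C (min a (gridPt m k))), gridPt_self hm, gridPt_zero,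
    min_eq_right ha]

lemma sum_mul_sub_one (m : ℕ) :
    ∑ k ∈ Finset.range m, ((m : ℝ) - k) * ((m : ℝ) - k - 1) = m * ((m : ℝ) ^ 2 - 1) / 3 := by
  induction m with
  | zero => simp
  | succ n ih =>
    rw [Finset.sum_range_succ', Finset.sum_congr rfl fun k _ => show
      (((n + 1 : ℕ) : ℝ) - (k + 1 : ℕ)) * (((n + 1 : ℕ) : ℝ) - (k + 1 : ℕ) - 1) =
        ((n : ℝ) - k) * ((n : ℝ) - k - 1) by push_cast; ring, ih]
    push_cast
    ring

namespace GridData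

variable {A B : Multiset ℝ} {a₀ b₀ : ℝ}

lemma disjoint (H : GridData m A B a₀ b₀) {x : ℝ} (hA : x ∈ A) : x ∉ B := by
  intro hB
  have hm : (0 : ℝ) < m := by have := H.ne_zero; positivity
  have hx1 := H.gridPt_one_le x hA
  have hx2 : x < 1 / 2 := by
    rcases H.lt_half with h | h
    · exact h x hA
    · exact h x hB
  have hx0 : 0 ≤ x := by
    refine le_trans ?_ hx1
    rw [gridPt_one]
    positivity
  set k := ⌊2 * m * x⌋₊ with hk
  have h1 : gridPt m k ≤ x := by
    rw [gridPt, div_le_iff₀ (by positivity), mul_comm x]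
    exact Nat.floor_le (by positivity)
  have h2 : x < gridPt m (k + 1) := by
    rw [gridPt, lt_div_iff₀ (by positivity), mul_comm x]
    push_cast
    exact Nat.lt_floor_add_one _
  have hk1 : 1 ≤ k := by
    rw [hk, Nat.one_le_floor_iff]
    rw [gridPt_one, div_le_iff₀ (by positivity)] at hx1
    linarith
  have hkm : k < m := by
    rw [← Nat.cast_lt (α := ℝ)]
    rw [gridPt, div_le_iff₀ (by positivity)] at h1
    nlinarith
  obtain ⟨i, hi⟩ : ∃ i, k = i + 1 := ⟨k - 1, by omega⟩
  rw [hi] at h1 h2 hkm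
  have h3 : gridPt m i < gridPt m (i + 1) := by
    rw [gridPt_succ]
    exact lt_add_of_pos_right _ (by positivity)
  rcases Nat.mod_two_eq_zero_or_one i with h | h
  · rcases H.avoid_right h hkm x hB with h' | h' <;> linarith
  · rcases H.avoid_left h hkm x hA with h' | h' <;> linarith

lemma pos_left (H : GridData m A B a₀ b₀) : ∀ a ∈ A, 0 < a := by
  intro a ha
  have hm : (0 : ℝ) < m := by have := H.ne_zero; positivity
  refine lt_of_lt_of_le ?_ (H.gridPt_one_le a ha)
  rw [gridPt_one]
  positivity

lemma minSum_left_zero (H : GridData m A B a₀ b₀) : minSum A 0 = 0 := by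
  rw [minSum, Multiset.map_congr rfl fun a ha => min_eq_right (H.pos_left a ha).le]
  simp

lemma const_eq (H : GridData m A B a₀ b₀) : a₀ = b₀ + minSum B 0 := by
  have h := H.eq_add 0 (Nat.zero_le m)
  rw [gridPt_zero, H.minSum_left_zero] at h
  simpa using h

lemma gridInc_mul (H : GridData m A B a₀ b₀) {k : ℕ} (hk : k < m) :
    gridInc m B k * gridInc m A k = ((m : ℝ) - k) * ((m : ℝ) - k - 1) / 4 := by
  rw [H.gridInc_left hk, H.gridInc_right hk]
  rcases Nat.even_or_odd' k with ⟨i, rfl | rfl⟩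
  · rw [show (2 * i + 1) / 2 = i by omega, show 2 * i / 2 = i by omega]
    push_cast
    ring
  · rw [show (2 * i + 1 + 1) / 2 = i + 1 by omega, show (2 * i + 1) / 2 = i by omega]
    push_cast
    ring

lemma minSum_right_of_mem_left (H : GridData m A B a₀ b₀) {a : ℝ} (ha : a ∈ A) :
    minSum B a = minSum B (min a (1 / 2)) := by
  rcases H.lt_half with h | h
  · rw [min_eq_left (h a ha).le]
  · rcases le_total a (1 / 2) with h1 | h1
    · rw [min_eq_left h1]
    · rw [min_eq_right h1, minSum, minSum]
      refine congrArg _ (Multiset.map_congr rfl fun b hb => ?_)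
      rw [min_eq_left (h b hb).le, min_eq_left ((h b hb).le.trans h1)]

lemma sum_minSum (H : GridData m A B a₀ b₀) :
    (A.map fun a => minSum B a - minSum B 0).sum = (m : ℝ) ^ 2 * ((m : ℝ) ^ 2 - 1) / 6 := by
  have h1 : (A.map fun a => minSum B a - minSum B 0).sum =
      (A.map fun a => ∑ k ∈ Finset.range m,
        2 * m * gridInc m B k * (min a (gridPt m (k + 1)) - min a (gridPt m k))).sum := by
    refine congrArg _ (Multiset.map_congr rfl fun a ha => ?_)
    rw [H.minSum_right_of_mem_left ha]
    exact minSum_min_half_sub_zero H.ne_zero (fun k hk => H.cell_right hk) (H.pos_left a ha).le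
  refine h1.trans ((Multiset.sum_map_sum_map A (Finset.range m).1).trans ?_)
  calc _ = ∑ k ∈ Finset.range m, (m : ℝ) / 2 * (((m : ℝ) - k) * ((m : ℝ) - k - 1)) := by
        refine Finset.sum_congr rfl fun k hk => ?_
        rw [Multiset.sum_map_mul_left, ← gridInc_eq_sum, mul_assoc,
          H.gridInc_mul (Finset.mem_range.mp hk)]
        ring
    _ = _ := by
        rw [← Finset.mul_sum, sum_mul_sub_one]
        ring

lemma minSum_right_even (H : GridData m A B a₀ b₀) {i : ℕ} (hi : 2 * i ≤ m) :
    minSum B (gridPt m (2 * i)) - minSum B 0 = i * ((m : ℝ) - i) := by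
  induction i with
  | zero => simp [gridPt_zero]
  | succ i ih =>
    have h1 := H.gridInc_right (k := 2 * i) (by omega)
    have h2 := H.gridInc_right (k := 2 * i + 1) (by omega)
    rw [gridInc, show 2 * i / 2 = i by omega] at h1
    rw [gridInc, show (2 * i + 1) / 2 = i by omega] at h2
    have h3 := ih (by omega)
    rw [show 2 * (i + 1) = 2 * i + 1 + 1 by omega]
    push_cast
    linarith

lemma minSum_right (H : GridData m A B a₀ b₀) {k : ℕ} (hk : k < m) {t : ℝ}
    (h1 : gridPt m k ≤ t) (h2 : t ≤ gridPt m (k + 1)) :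
    minSum B t - minSum B 0 = (k / 2 : ℕ) * ((m : ℝ) - (k / 2 : ℕ)) +
      (m * t - (k / 2 : ℕ)) * ((m : ℝ) - 1 - 2 * (k / 2 : ℕ)) := by
  have hm : (0 : ℝ) < m := by have := H.ne_zero; positivity
  have h := minSum_of_mem_cell H.ne_zero (H.cell_right hk) h1 h2
  have h3 := H.gridInc_right hk
  rcases Nat.even_or_odd' k with ⟨i, rfl | rfl⟩
  · have h4 := H.minSum_right_even (i := i) (by omega)
    rw [show 2 * i / 2 = i by omega] at *
    rw [h3] at h
    rw [← h4]
    have : (m : ℝ) * gridPt m (2 * i) = i := by rw [gridPt]; push_cast; field_simp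
    linear_combination h - ((m : ℝ) - 1 - 2 * i) * this
  · have h4 := H.minSum_right_even (i := i) (by omega)
    have h5 := H.gridInc_right (k := 2 * i) (by omega)
    rw [gridInc, show 2 * i / 2 = i by omega] at h5
    rw [show (2 * i + 1) / 2 = i by omega] at *
    rw [h3] at h
    rw [← h4]
    have : (m : ℝ) * gridPt m (2 * i + 1) = i + 1 / 2 := by
      rw [gridPt]; push_cast; field_simp
    linear_combination h + h5 - ((m : ℝ) - 1 - 2 * i) * this

lemma countP_left (H : GridData m A B a₀ b₀) {k : ℕ} (hk : k < m) {t : ℝ}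
    (h1 : gridPt m k < t) (h2 : t < gridPt m (k + 1)) :
    (A.countP (t < ·) : ℝ) = m * (m - 2 * ((k + 1) / 2 : ℕ)) := by
  rw [countP_lt_of_mem_cell H.ne_zero (H.cell_left hk) h1 h2, H.gridInc_left hk]
  ring

lemma countP_right (H : GridData m A B a₀ b₀) {k : ℕ} (hk : k < m) {t : ℝ}
    (h1 : gridPt m k < t) (h2 : t < gridPt m (k + 1)) :
    (B.countP (t < ·) : ℝ) = m * (m - 1 - 2 * (k / 2 : ℕ)) := by
  rw [countP_lt_of_mem_cell H.ne_zero (H.cell_right hk) h1 h2, H.gridInc_right hk]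
  ring

end GridData

end GridSums

section NewtonPolygon

variable {K}

open Classical in
/-- The valuation of `α` in units of the valuation of `q`, truncated to `1` at `α = 0`. -/
def qval (q α : K) : ℝ := if α = 0 then 1 else Real.log ‖α‖ / Real.log ‖q‖

lemma qval_zero (q : K) : qval q 0 = 1 := if_pos rfl

variable {q : K}

lemma norm_eq_rpow_qval (hq0 : q ≠ 0) (hq1 : ‖q‖ < 1) {α : K} (hα : α ≠ 0) :
    ‖α‖ = ‖q‖ ^ qval q α := by
  have h := norm_pos_iff.mpr hq0
  have hlog := (Real.log_neg h hq1).ne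
  rw [qval, if_neg hα, Real.rpow_def_of_pos h, mul_div_cancel₀ _ hlog,
    Real.exp_log (norm_pos_iff.mpr hα)]

lemma rpow_min {ρ : ℝ} (h0 : 0 < ρ) (h1 : ρ < 1) (s t : ℝ) :
    ρ ^ min s t = max (ρ ^ s) (ρ ^ t) :=
  (Real.antitone_rpow_of_base_le_one h0 h1.le).map_min

lemma norm_sub_eq_rpow_min (hq0 : q ≠ 0) (hq1 : ‖q‖ < 1) {x α : K} {t : ℝ}
    (hx : ‖x‖ = ‖q‖ ^ t) (ht : t ≤ 1) (hne : qval q α ≠ t) :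
    ‖x - α‖ = ‖q‖ ^ min (qval q α) t := by
  have h := norm_pos_iff.mpr hq0
  rcases eq_or_ne α 0 with rfl | hα
  · rw [sub_zero, qval_zero, min_eq_right ht, hx]
  · have hα' := norm_eq_rpow_qval hq0 hq1 hα
    have h1 : ‖x‖ ≠ ‖-α‖ := by
      rw [norm_neg, hx, hα']
      exact fun he => hne ((Real.rpow_right_inj h hq1.ne).mp he).symm
    rw [sub_eq_add_neg, IsUltrametricDist.norm_add_eq_max_of_norm_ne_norm h1, norm_neg, hx, hα',
      rpow_min h hq1, max_comm]

lemma norm_multiset_prod_sub (hq0 : q ≠ 0) {S : Multiset K} {x : K} {t : ℝ}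
    (hS : ∀ α ∈ S, ‖x - α‖ = ‖q‖ ^ min (qval q α) t) :
    ‖(S.map (x - ·)).prod‖ = ‖q‖ ^ minSum (S.map (qval q)) t := by
  have h := norm_pos_iff.mpr hq0
  induction S using Multiset.induction_on with
  | empty => simp [minSum]
  | cons α S ih =>
    rw [Multiset.map_cons, Multiset.prod_cons, norm_mul, hS α (Multiset.mem_cons_self α S),
      ih fun β hβ => hS β (Multiset.mem_cons_of_mem hβ), ← Real.rpow_add h]
    simp [minSum]

lemma norm_eval_eq_rpow [IsAlgClosed K] (hq0 : q ≠ 0) (hq1 : ‖q‖ < 1) {p : Polynomial K}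
    (hp : p ≠ 0) {x : K} {t : ℝ}
    (hS : ∀ α ∈ p.roots, ‖x - α‖ = ‖q‖ ^ min (qval q α) t) :
    ‖p.eval x‖ = ‖q‖ ^ (qval q p.leadingCoeff + minSum (p.roots.map (qval q)) t) := by
  rw [(IsAlgClosed.splits p).eval_eq_prod_roots, norm_mul, norm_multiset_prod_sub hq0 hS,
    norm_eq_rpow_qval hq0 hq1 (Polynomial.leadingCoeff_ne_zero.mpr hp),
    Real.rpow_add (norm_pos_iff.mpr hq0)]

lemma continuous_minSum (A : Multiset ℝ) : Continuous (minSum A) := by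
  induction A using Multiset.induction_on with
  | empty => simpa [minSum, Function.const_def] using! continuous_const
  | cons a A ih =>
    have : minSum (a ::ₘ A) = fun t => min a t + minSum A t := by
      ext t
      simp [minSum]
    rw [this]
    fun_prop

lemma norm_coe_unitAddCircle_of_le_half {t : ℝ} (h0 : 0 ≤ t) (h1 : t ≤ 1 / 2) :
    ‖(t : UnitAddCircle)‖ = t := by
  rw [(AddCircle.norm_coe_eq_abs_iff (p := 1) one_ne_zero).mpr, abs_of_nonneg h0]
  rwa [abs_of_nonneg h0, abs_one]

lemma norm_coe_unitAddCircle_half_natCast (k : ℕ) :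
    ‖((k / 2 : ℝ) : UnitAddCircle)‖ = ((k % 2 : ℕ) : ℝ) / 2 := by
  have h : ((k / 2 : ℝ) : UnitAddCircle) = ((((k % 2 : ℕ) : ℝ) / 2 : ℝ) : UnitAddCircle) := by
    rw [← sub_eq_zero, ← AddCircle.coe_sub, AddCircle.coe_eq_zero_iff]
    refine ⟨(k / 2 : ℕ), ?_⟩
    have : (k : ℝ) = (k % 2 : ℕ) + 2 * (k / 2 : ℕ) := by exact_mod_cast (Nat.mod_add_div k 2).symm
    simp only [zsmul_eq_mul, Int.cast_natCast, mul_one]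
    linarith
  rw [h]
  have h2 : ((k % 2 : ℕ) : ℝ) ≤ 1 := by exact_mod_cast Nat.le_of_lt_succ (Nat.mod_lt k two_pos)
  exact norm_coe_unitAddCircle_of_le_half (by positivity) (by linarith)

/-- The functional equation of a Lattès map `p / r` on generic points of the segment
`0 < t < 1/2`, in terms of absolute values. -/
def TateRelation (q : K) (m : ℕ) (p r : Polynomial K) : Prop :=
  ∀ t : ℚ, 0 < (t : ℝ) → (t : ℝ) < 1 / 2 → (∀ n : ℤ, 2 * ((m : ℝ) * t) ≠ n) →
    ∃ x : K, ‖x‖ = ‖q‖ ^ (t : ℝ) ∧ r.eval x ≠ 0 ∧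
      ‖p.eval x‖ = ‖q‖ ^ ‖((m * t : ℝ) : UnitAddCircle)‖ * ‖r.eval x‖

namespace TateRelation

variable {m : ℕ} {p r : Polynomial K}

lemma ne_zero (H : TateRelation q m p r) (hq0 : q ≠ 0) (hm : 2 ≤ m) : p ≠ 0 ∧ r ≠ 0 := by
  have hm0 : (0 : ℝ) < m := by positivity
  have hm2 : (2 : ℝ) ≤ m := by exact_mod_cast hm
  obtain ⟨x, -, hr, hp⟩ := H (1 / (4 * m)) (by push_cast; positivity)
    (by push_cast; rw [div_lt_div_iff₀ (by positivity) (by positivity)]; linarith) (by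
      intro n hn
      have h1 : (2 : ℝ) * n = (1 : ℤ) := by
        rw [← hn]
        push_cast
        field_simp
        norm_num
      have h2 : 2 * n = 1 := by exact_mod_cast h1
      omega)
  refine ⟨?_, ?_⟩
  · rintro rfl
    have h := norm_pos_iff.mpr hq0
    rw [Polynomial.eval_zero, norm_zero] at hp
    exact absurd hp.symm (by positivity)
  · rintro rfl
    exact hr Polynomial.eval_zero

variable [IsAlgClosed K]

lemma add_minSum (H : TateRelation q m p r) (hq0 : q ≠ 0) (hq1 : ‖q‖ < 1) (hm : 2 ≤ m) {t : ℝ}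
    (ht : t ∈ Set.Icc (0 : ℝ) (1 / 2)) :
    qval q p.leadingCoeff + minSum (p.roots.map (qval q)) t =
      qval q r.leadingCoeff + minSum (r.roots.map (qval q)) t +
        ‖((m * t : ℝ) : UnitAddCircle)‖ := by
  obtain ⟨hp, hr⟩ := H.ne_zero hq0 hm
  have hq := norm_pos_iff.mpr hq0
  have hm0 : (0 : ℝ) < m := by positivity
  set A := p.roots.map (qval q) with hA
  set B := r.roots.map (qval q) with hB
  set bad : Set ℝ := {x | x ∈ A} ∪ {x | x ∈ B} ∪ ((Finset.range m).image (gridPt m) : Finset ℝ)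
    with hbad
  have hfin : bad.Finite :=
    ((Multiset.finite_toSet A).union (Multiset.finite_toSet B)).union (Finset.finite_toSet _)
  have hdense : Dense (Set.range ((↑) : ℚ → ℝ) \ bad) :=
    Dense.sdiff_finite Rat.denseRange_cast hfin
  have hsub : Set.Icc (0 : ℝ) (1 / 2) ⊆
      closure (Set.Ioo (0 : ℝ) (1 / 2) ∩ (Set.range ((↑) : ℚ → ℝ) \ bad)) := by
    rw [← closure_Ioo (by norm_num : (0 : ℝ) ≠ 1 / 2)]
    exact closure_minimal (hdense.open_subset_closure_inter isOpen_Ioo) isClosed_closure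
  have hgood : Set.EqOn (fun t => qval q p.leadingCoeff + minSum A t)
      (fun t => qval q r.leadingCoeff + minSum B t + ‖((m * t : ℝ) : UnitAddCircle)‖)
      (Set.Ioo (0 : ℝ) (1 / 2) ∩ (Set.range ((↑) : ℚ → ℝ) \ bad)) := by
    rintro _ ⟨⟨h0, h1⟩, ⟨t, rfl⟩, hnb⟩
    have hn : ∀ n : ℤ, 2 * ((m : ℝ) * t) ≠ n := by
      intro n hn
      have hn0 : 0 < n := by
        have : (0 : ℝ) < n := by rw [← hn]; positivity
        exact_mod_cast this
      lift n to ℕ using hn0.le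
      have hnm : n < m := by
        have : (n : ℝ) < m := by
          push_cast at hn
          nlinarith
        exact_mod_cast this
      refine hnb (Or.inr ?_)
      rw [Finset.coe_image]
      refine ⟨n, by simpa using hnm, ?_⟩
      push_cast at hn
      rw [gridPt, ← hn]
      field_simp
    have hnA : (t : ℝ) ∉ A := fun h => hnb (Or.inl (Or.inl h))
    have hnB : (t : ℝ) ∉ B := fun h => hnb (Or.inl (Or.inr h))
    obtain ⟨x, hx, -, he⟩ := H t h0 h1 hn
    rw [norm_eval_eq_rpow hq0 hq1 hp fun α hα => norm_sub_eq_rpow_min hq0 hq1 hx (by linarith)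
        fun h => hnA (h ▸ Multiset.mem_map_of_mem _ hα),
      norm_eval_eq_rpow hq0 hq1 hr fun α hα => norm_sub_eq_rpow_min hq0 hq1 hx (by linarith)
        fun h => hnB (h ▸ Multiset.mem_map_of_mem _ hα),
      ← Real.rpow_add hq, Real.rpow_right_inj hq hq1.ne] at he
    dsimp only
    rw [he, add_comm]
  have hcont := continuous_minSum A
  have hcont' := continuous_minSum B
  have hcirc : Continuous fun t : ℝ => ‖((m * t : ℝ) : UnitAddCircle)‖ :=
    continuous_norm.comp ((AddCircle.continuous_mk' 1).comp (continuous_const.mul continuous_id))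
  exact (hgood.closure (by fun_prop) (by fun_prop)) (hsub ht)

lemma gridData (H : TateRelation q m p r) (hq0 : q ≠ 0) (hq1 : ‖q‖ < 1) (hm : 2 ≤ m)
    (hp : p.natDegree ≤ m ^ 2) :
    GridData m (p.roots.map (qval q)) (r.roots.map (qval q)) (qval q p.leadingCoeff)
      (qval q r.leadingCoeff) where
  two_le := hm
  card_le := by
    rw [Multiset.card_map]
    exact (Polynomial.card_roots' p).trans hp
  eq_add k hk := by
    have hm0 : (m : ℝ) ≠ 0 := by positivity
    have h1 : gridPt m k ∈ Set.Icc (0 : ℝ) (1 / 2) := by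
      refine ⟨by rw [gridPt]; positivity, ?_⟩
      rw [← gridPt_self (m := m) (by omega)]
      exact gridPt_mono m hk
    rw [H.add_minSum hq0 hq1 hm h1, ← norm_coe_unitAddCircle_half_natCast k,
      show (m : ℝ) * gridPt m k = k / 2 by rw [gridPt]; field_simp]

end TateRelation

end NewtonPolygon

section ResultantValue

variable {K} {q : K} {m : ℕ} {p r : Polynomial K}

lemma GridData.norm_sub_eq (H : GridData m (p.roots.map (qval q)) (r.roots.map (qval q))
    (qval q p.leadingCoeff) (qval q r.leadingCoeff)) (hq0 : q ≠ 0) (hq1 : ‖q‖ < 1) {α β : K}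
    (hα : α ∈ p.roots) (hβ : β ∈ r.roots) :
    ‖α - β‖ = ‖q‖ ^ min (qval q β) (qval q α) := by
  have hA := Multiset.mem_map_of_mem (qval q) hα
  have hB := Multiset.mem_map_of_mem (qval q) hβ
  have hne : qval q α ≠ qval q β := fun h => H.disjoint hA (h ▸ hB)
  have hlt : qval q α < 1 / 2 ∨ qval q β < 1 / 2 :=
    H.lt_half.imp (fun h => h _ hA) fun h => h _ hB
  rcases le_or_gt (qval q α) 1 with h1 | h1
  · rcases eq_or_ne α 0 with rfl | hα0
    · rw [qval_zero] at *
      have hβ0 : β ≠ 0 := by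
        rintro rfl
        exact hne (qval_zero q).symm
      have : qval q β < 1 / 2 := hlt.resolve_left (by norm_num)
      rw [zero_sub, norm_neg, min_eq_left (by linarith), norm_eq_rpow_qval hq0 hq1 hβ0]
    · exact norm_sub_eq_rpow_min hq0 hq1 (norm_eq_rpow_qval hq0 hq1 hα0) h1 hne.symm
  · have hβ1 : qval q β < 1 / 2 := hlt.resolve_left (by linarith)
    have hβ0 : β ≠ 0 := by
      rintro rfl
      rw [qval_zero] at hβ1
      norm_num at hβ1
    rw [norm_sub_rev, min_comm]
    exact norm_sub_eq_rpow_min hq0 hq1 (norm_eq_rpow_qval hq0 hq1 hβ0) (by linarith) hne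

lemma norm_multiset_prod_eq_rpow (hq0 : q ≠ 0) {S : Multiset K} {f : K → K} {φ : K → ℝ}
    (hS : ∀ α ∈ S, ‖f α‖ = ‖q‖ ^ φ α) : ‖(S.map f).prod‖ = ‖q‖ ^ (S.map φ).sum := by
  have h := norm_pos_iff.mpr hq0
  induction S using Multiset.induction_on with
  | empty => simp
  | cons α S ih =>
    rw [Multiset.map_cons, Multiset.prod_cons, norm_mul, hS α (Multiset.mem_cons_self α S),
      ih fun β hβ => hS β (Multiset.mem_cons_of_mem hβ), ← Real.rpow_add h]
    simp

lemma GridData.natDegree_eq [IsAlgClosed K] (H : GridData m (p.roots.map (qval q))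
    (r.roots.map (qval q)) (qval q p.leadingCoeff) (qval q r.leadingCoeff)) :
    p.natDegree = m ^ 2 := by
  rw [← IsAlgClosed.card_roots_eq_natDegree, ← H.card_left, Multiset.card_map]

lemma GridData.norm_resultant [IsAlgClosed K] (H : GridData m (p.roots.map (qval q))
    (r.roots.map (qval q)) (qval q p.leadingCoeff) (qval q r.leadingCoeff)) (hq0 : q ≠ 0)
    (hq1 : ‖q‖ < 1) (hp : p ≠ 0) (hr : r ≠ 0) (hrd : r.natDegree ≤ m ^ 2) :
    ‖p.resultant r (m ^ 2) (m ^ 2)‖ = ‖q‖ ^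
      (2 * (m : ℝ) ^ 2 * qval q p.leadingCoeff + (m : ℝ) ^ 2 * ((m : ℝ) ^ 2 - 1) / 6) := by
  have hq := norm_pos_iff.mpr hq0
  have h1 := Polynomial.resultant_eq_prod_eval p r (m ^ 2) hrd (IsAlgClosed.splits p)
  rw [H.natDegree_eq] at h1
  have h2 : ∀ α ∈ p.roots, ‖r.eval α‖ = ‖q‖ ^
      (qval q p.leadingCoeff + (minSum (r.roots.map (qval q)) (qval q α) -
        minSum (r.roots.map (qval q)) 0)) := by
    intro α hα
    rw [norm_eval_eq_rpow hq0 hq1 hr fun β hβ => H.norm_sub_eq hq0 hq1 hα hβ]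
    congr 1
    have := H.const_eq
    linarith
  have h3 := H.sum_minSum
  rw [Multiset.map_map] at h3
  have h4 : (Multiset.card p.roots : ℝ) = (m : ℝ) ^ 2 := by
    rw [IsAlgClosed.card_roots_eq_natDegree, H.natDegree_eq]
    push_cast
    rfl
  rw [h1, norm_mul, norm_pow, norm_multiset_prod_eq_rpow hq0 h2,
    norm_eq_rpow_qval hq0 hq1 (Polynomial.leadingCoeff_ne_zero.mpr hp), ← Real.rpow_natCast,
    ← Real.rpow_mul hq.le, ← Real.rpow_add hq, Multiset.sum_map_add]
  congr 1
  simp only [Function.comp_def] at h3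
  rw [h3, Multiset.map_const', Multiset.sum_replicate, nsmul_eq_mul, h4]
  push_cast
  ring

end ResultantValue

section Dominance

variable {K}

lemma Dominant.linear_mul_of_norm_lt {p : Polynomial K} {j : ℕ} {c : ℝ} (h : Dominant p j c)
    {s α : K} (hs : ‖α‖ < ‖s‖) :
    Dominant ((Polynomial.C s * Polynomial.X - Polynomial.C α) * p) (j + 1) (‖s‖ * c) := by
  have hc := h.pos
  have hs0 : 0 < ‖s‖ := (norm_nonneg α).trans_lt hs
  have hcoeff : ∀ i, ((Polynomial.C s * Polynomial.X - Polynomial.C α) * p).coeff (i + 1) =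
      s * p.coeff i + -(α * p.coeff (i + 1)) := by
    intro i
    rw [sub_mul, mul_assoc, Polynomial.coeff_sub, Polynomial.coeff_C_mul, Polynomial.coeff_X_mul,
      Polynomial.coeff_C_mul, sub_eq_add_neg]
  have hα : ∀ i, ‖-(α * p.coeff i)‖ < ‖s‖ * c := by
    intro i
    rw [norm_neg, norm_mul]
    exact (mul_le_mul_of_nonneg_left (h.norm_coeff_le i) (norm_nonneg α)).trans_lt
      (mul_lt_mul_of_pos_right hs hc)
  refine ⟨?_, fun i hi => ?_⟩
  · rw [hcoeff]
    exact norm_add_eq_of_lt (by rw [norm_mul, h.1]) (hα _)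
  · cases i with
    | zero =>
      have : ((Polynomial.C s * Polynomial.X - Polynomial.C α) * p).coeff 0 =
          -(α * p.coeff 0) := by simp [Polynomial.mul_coeff_zero]
      rw [this]
      exact hα 0
    | succ i =>
      rw [hcoeff]
      refine (IsUltrametricDist.norm_add_le_max _ _).trans_lt (max_lt ?_ (hα _))
      rw [norm_mul]
      exact mul_lt_mul_of_pos_left (h.2 i (by omega)) hs0

lemma Dominant.linear_mul_of_lt_norm {p : Polynomial K} {j : ℕ} {c : ℝ} (h : Dominant p j c)
    {s α : K} (hs : ‖s‖ < ‖α‖) :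
    Dominant ((Polynomial.C s * Polynomial.X - Polynomial.C α) * p) j (‖α‖ * c) := by
  have hc := h.pos
  have hα0 : 0 < ‖α‖ := (norm_nonneg s).trans_lt hs
  have hcoeff : ∀ i, ((Polynomial.C s * Polynomial.X - Polynomial.C α) * p).coeff i =
      -(α * p.coeff i) + s * (Polynomial.X * p).coeff i := by
    intro i
    rw [sub_mul, mul_assoc, Polynomial.coeff_sub, Polynomial.coeff_C_mul,
      Polynomial.coeff_C_mul]
    ring
  have hX : ∀ i, ‖(Polynomial.X * p).coeff i‖ ≤ c := by
    intro i
    cases i with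
    | zero => simpa [Polynomial.mul_coeff_zero] using hc.le
    | succ i =>
      rw [Polynomial.coeff_X_mul]
      exact h.norm_coeff_le i
  have hlt : ∀ i, ‖s * (Polynomial.X * p).coeff i‖ < ‖α‖ * c := by
    intro i
    rw [norm_mul]
    exact (mul_le_mul_of_nonneg_left (hX i) (norm_nonneg s)).trans_lt
      (mul_lt_mul_of_pos_right hs hc)
  refine ⟨?_, fun i hi => ?_⟩
  · rw [hcoeff]
    exact norm_add_eq_of_lt (by rw [norm_neg, norm_mul, h.1]) (hlt _)
  · rw [hcoeff]
    refine (IsUltrametricDist.norm_add_le_max _ _).trans_lt (max_lt ?_ (hlt _))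
    rw [norm_neg, norm_mul]
    exact mul_lt_mul_of_pos_left (h.2 i hi) hα0

lemma Dominant.C_mul {p : Polynomial K} {j : ℕ} {c : ℝ} (h : Dominant p j c) {a : K}
    (ha : a ≠ 0) : Dominant (Polynomial.C a * p) j (‖a‖ * c) := by
  refine ⟨?_, fun i hi => ?_⟩
  · rw [Polynomial.coeff_C_mul, norm_mul, h.1]
  · rw [Polynomial.coeff_C_mul, norm_mul]
    exact mul_lt_mul_of_pos_left (h.2 i hi) (norm_pos_iff.mpr ha)

lemma dominant_one : Dominant (1 : Polynomial K) 0 1 := by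
  refine ⟨by simp, fun i hi => ?_⟩
  rw [Polynomial.coeff_one, if_neg hi]
  simp

variable {q : K}

lemma dominant_prod_comp (hq0 : q ≠ 0) (hq1 : ‖q‖ < 1) {s : K} {t : ℝ} (hs : ‖s‖ = ‖q‖ ^ t)
    (ht : t ≤ 1) {S : Multiset K} (hS : t ∉ S.map (qval q)) :
    Dominant ((S.map fun α => Polynomial.C s * Polynomial.X - Polynomial.C α).prod)
      ((S.map (qval q)).countP (t < ·)) (‖q‖ ^ minSum (S.map (qval q)) t) := by
  have hq := norm_pos_iff.mpr hq0
  induction S using Multiset.induction_on with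
  | empty => simpa [minSum] using dominant_one (K := K)
  | cons α S ih =>
    rw [Multiset.map_cons, Multiset.mem_cons, not_or] at hS
    have h := ih hS.2
    have hsum : minSum ((α ::ₘ S).map (qval q)) t =
        min (qval q α) t + minSum (S.map (qval q)) t := by simp [minSum]
    rw [Multiset.map_cons, Multiset.prod_cons, hsum, Real.rpow_add hq, Multiset.map_cons]
    rcases lt_or_gt_of_ne hS.1 with hlt | hlt
    · rw [Multiset.countP_cons_of_pos _ hlt, min_eq_right hlt.le, ← hs]
      refine h.linear_mul_of_norm_lt ?_
      rcases eq_or_ne α 0 with rfl | hα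
      · rw [norm_zero, hs]
        positivity
      · rw [norm_eq_rpow_qval hq0 hq1 hα, hs]
        exact Real.rpow_lt_rpow_of_exponent_gt hq hq1 hlt
    · have hα : α ≠ 0 := by
        rintro rfl
        rw [qval_zero] at hlt
        linarith
      rw [Multiset.countP_cons_of_neg _ (by linarith), min_eq_left hlt.le,
        ← norm_eq_rpow_qval hq0 hq1 hα]
      refine h.linear_mul_of_lt_norm ?_
      rw [norm_eq_rpow_qval hq0 hq1 hα, hs]
      exact Real.rpow_lt_rpow_of_exponent_gt hq hq1 hlt

lemma dominant_comp [IsAlgClosed K] (hq0 : q ≠ 0) (hq1 : ‖q‖ < 1) {s : K} {t : ℝ}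
    (hs : ‖s‖ = ‖q‖ ^ t) (ht : t ≤ 1) {p : Polynomial K} (hp : p ≠ 0)
    (hS : t ∉ p.roots.map (qval q)) :
    Dominant (p.comp (Polynomial.C s * Polynomial.X)) ((p.roots.map (qval q)).countP (t < ·))
      (‖q‖ ^ (qval q p.leadingCoeff + minSum (p.roots.map (qval q)) t)) := by
  have hlc := Polynomial.leadingCoeff_ne_zero.mpr hp
  have h : p.comp (Polynomial.C s * Polynomial.X) = Polynomial.C p.leadingCoeff *
      (p.roots.map fun α => Polynomial.C s * Polynomial.X - Polynomial.C α).prod := by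
    conv_lhs => rw [(IsAlgClosed.splits p).eq_prod_roots]
    simp [Polynomial.multiset_prod_comp]
  rw [h, Real.rpow_add (norm_pos_iff.mpr hq0), ← norm_eq_rpow_qval hq0 hq1 hlc]
  exact (dominant_prod_comp hq0 hq1 hs ht hS).C_mul hlc

end Dominance

section MinimalResultant

variable {K} {q : K} {m : ℕ} [IsAlgClosed K]

lemma TateRelation.Rmin_eq {F G : MvPolynomial (Fin 2) K} (hF : F.IsHomogeneous (m ^ 2))
    (hG : G.IsHomogeneous (m ^ 2)) (H : TateRelation q m (dehom F) (dehom G)) (hq0 : q ≠ 0)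
    (hq1 : ‖q‖ < 1) (hm : 2 ≤ m) {t : ℚ} {k : ℕ} (hk : k < m) (hkt : gridPt m k < t)
    (htk : t < gridPt m (k + 1)) (hfold : ‖((m * t : ℝ) : UnitAddCircle)‖ = t)
    (h1 : 2 * ((m : ℝ) * (m - 2 * ((k + 1) / 2 : ℕ))) ≤ (m : ℝ) ^ 2 + 1 ∨
      2 * ((m : ℝ) * (m - 1 - 2 * (k / 2 : ℕ))) + 1 ≤ (m : ℝ) ^ 2)
    (h2 : (m : ℝ) ^ 2 + 1 ≤ 2 * ((m : ℝ) * (m - 2 * ((k + 1) / 2 : ℕ))) ∨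
      (m : ℝ) ^ 2 ≤ 2 * ((m : ℝ) * (m - 1 - 2 * (k / 2 : ℕ))) + 1) :
    Rmin K (m ^ 2) F G = ((m : ℝ) ^ 2 * ((m : ℝ) ^ 2 - 1) / 6 + ((m : ℝ) ^ 4 - (m : ℝ) ^ 2) * t -
      2 * (m : ℝ) ^ 2 * ((k / 2 : ℕ) * ((m : ℝ) - (k / 2 : ℕ)) +
        (m * t - (k / 2 : ℕ)) * ((m : ℝ) - 1 - 2 * (k / 2 : ℕ)))) * ordv K q := by
  have hq := norm_pos_iff.mpr hq0
  obtain ⟨hp, hr⟩ := H.ne_zero hq0 hm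
  have hpd := natDegree_dehom_le hF
  have hrd := natDegree_dehom_le hG
  have D := H.gridData hq0 hq1 hm hpd
  have ht0 : (0 : ℝ) ≤ t := by
    refine le_trans ?_ hkt.le
    rw [gridPt]
    positivity
  have ht1 : (t : ℝ) ≤ 1 / 2 := by
    rw [← gridPt_self D.ne_zero]
    exact htk.le.trans (gridPt_mono m hk)
  have hadd := H.add_minSum hq0 hq1 hm ⟨ht0, ht1⟩
  rw [hfold] at hadd
  have hsum := D.minSum_right hk hkt.le htk.le
  have hj := D.countP_left hk hkt htk
  have hl := D.countP_right hk hkt htk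
  have hres := D.norm_resultant hq0 hq1 hp hr hrd
  have hconst := D.const_eq
  obtain ⟨s, hs0, hs⟩ := exists_norm_eq_rpow hq0 t
  have hA : (t : ℝ) ∉ (dehom F).roots.map (qval q) := fun h => by
    rcases D.cell_left hk _ h with h | h <;> linarith
  have hB : (t : ℝ) ∉ (dehom G).roots.map (qval q) := fun h => by
    rcases D.cell_right hk _ h with h | h <;> linarith
  have DF := dominant_comp hq0 hq1 hs (by linarith) hp hA
  have DG := dominant_comp hq0 hq1 hs (by linarith) hr hB
  set A := (dehom F).roots.map (qval q) with hAdef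
  set B := (dehom G).roots.map (qval q) with hBdef
  set j := A.countP ((t : ℝ) < ·)
  set l := B.countP ((t : ℝ) < ·)
  have hjd : j ≤ m ^ 2 := (Multiset.countP_le_card _ A).trans D.card_left.le
  have hld : l ≤ m ^ 2 := by
    refine (Multiset.countP_le_card _ B).trans ?_
    rw [hBdef, Multiset.card_map]
    exact (Polynomial.card_roots' _).trans hrd
  set c := ‖q‖ ^ (qval q (dehom G).leadingCoeff + minSum B t) with hc
  have e1 : dehom (conjPair K (upperGL s 0 1 hs0 one_ne_zero) F G).1 =
      Polynomial.C s⁻¹ * (dehom F).comp (Polynomial.C s * Polynomial.X) := by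
    rw [conjPair_upperGL, dehom_add, dehom_C_mul, dehom_C_mul,
      dehom_mobius_upper _ _ _ one_ne_zero hF]
    simp
  have e2 : dehom (conjPair K (upperGL s 0 1 hs0 one_ne_zero) F G).2 =
      (dehom G).comp (Polynomial.C s * Polynomial.X) := by
    rw [conjPair_upperGL, dehom_C_mul, dehom_mobius_upper _ _ _ one_ne_zero hG]
    simp
  have hcF : ‖s⁻¹‖ * ‖q‖ ^ (qval q (dehom F).leadingCoeff + minSum A t) = c := by
    rw [norm_inv, hs, ← Real.rpow_neg hq.le, ← Real.rpow_add hq, hadd, hc]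
    congr 1
    ring
  have DF' : Dominant (dehom (conjPair K (upperGL s 0 1 hs0 one_ne_zero) F G).1) j c := by
    rw [e1, ← hcF]
    exact DF.C_mul (inv_ne_zero hs0)
  have DG' : Dominant (dehom (conjPair K (upperGL s 0 1 hs0 one_ne_zero) F G).2) l c := by
    rw [e2]
    exact DG
  rw [← bres_eq_resultant hF hG] at hres
  have h0 : bres (m ^ 2) F G ≠ 0 := by
    rw [← norm_pos_iff, hres]
    positivity
  have hd : 1 ≤ m ^ 2 := Nat.one_le_pow _ _ (by omega)
  rw [Rmin_eq_of_dominant hd hjd hld hF hG h0 _ DF' DG'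
    (h1.imp (fun h => by rw [← hj] at h; exact_mod_cast h)
      fun h => by rw [← hl] at h; exact_mod_cast h)
    (h2.imp (fun h => by rw [← hj] at h; exact_mod_cast h)
      fun h => by rw [← hl] at h; exact_mod_cast h)]
  have hdet : ((upperGL s 0 1 hs0 one_ne_zero : GL (Fin 2) K) : Matrix (Fin 2) (Fin 2) K).det =
      s := by simp [upperGL]
  rw [hdet, hs, ordv, ordv, hres, hc, Real.log_rpow hq, Real.log_rpow hq, Real.log_rpow hq, ← hsum]
  push_cast
  linear_combination (-2 * (m : ℝ) ^ 2 * Real.log ‖q‖) * hconst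

lemma norm_coe_unitAddCircle_eq {x t : ℝ} (n : ℤ) (h : |x - n| = t) (ht : t ≤ 1 / 2) :
    ‖(x : UnitAddCircle)‖ = t := by
  have h1 : (x : UnitAddCircle) = ((x - n : ℝ) : UnitAddCircle) := by
    rw [← sub_eq_zero, ← AddCircle.coe_sub, AddCircle.coe_eq_zero_iff]
    exact ⟨n, by simp⟩
  rw [h1, (AddCircle.norm_coe_eq_abs_iff (p := 1) one_ne_zero).mpr, h]
  rwa [h, abs_one]

lemma TateRelation.Rmin_of_odd {F G : MvPolynomial (Fin 2) K} (hF : F.IsHomogeneous (m ^ 2))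
    (hG : G.IsHomogeneous (m ^ 2)) (H : TateRelation q m (dehom F) (dehom G)) (hq0 : q ≠ 0)
    (hq1 : ‖q‖ < 1) (hm : 2 ≤ m) (hodd : Odd m) :
    Rmin K (m ^ 2) F G = ((m : ℝ) ^ 2 * ((m : ℝ) ^ 2 - 1) / 24) * ordv K q := by
  obtain ⟨i, rfl⟩ := hodd
  rcases Nat.even_or_odd' i with ⟨n, rfl | rfl⟩
  · rw [H.Rmin_eq hF hG hq0 hq1 hm (t := 1 / 4) (k := 2 * n) (by omega)]
    · rw [show 2 * n / 2 = n by omega]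
      push_cast
      ring
    · rw [gridPt, div_lt_iff₀ (by positivity)]
      push_cast
      linarith
    · rw [gridPt, lt_div_iff₀ (by positivity)]
      push_cast
      linarith
    · refine norm_coe_unitAddCircle_eq n ?_ (by norm_num)
      rw [abs_of_nonneg] <;> push_cast <;> linarith
    · right
      rw [show 2 * n / 2 = n by omega]
      push_cast
      nlinarith
    · left
      rw [show (2 * n + 1) / 2 = n by omega]
      push_cast
      nlinarith
  · rw [H.Rmin_eq hF hG hq0 hq1 hm (t := 1 / 4) (k := 2 * n + 1) (by omega)]
    · rw [show (2 * n + 1) / 2 = n by omega]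
      push_cast
      ring
    · rw [gridPt, div_lt_iff₀ (by positivity)]
      push_cast
      linarith
    · rw [gridPt, lt_div_iff₀ (by positivity)]
      push_cast
      linarith
    · refine norm_coe_unitAddCircle_eq (n + 1) ?_ (by norm_num)
      rw [abs_of_nonpos] <;> push_cast <;> linarith
    · left
      rw [show (2 * n + 1 + 1) / 2 = n + 1 by omega]
      push_cast
      nlinarith
    · right
      rw [show (2 * n + 1) / 2 = n by omega]
      push_cast
      nlinarith

lemma TateRelation.Rmin_of_even {F G : MvPolynomial (Fin 2) K} (hF : F.IsHomogeneous (m ^ 2))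
    (hG : G.IsHomogeneous (m ^ 2)) (H : TateRelation q m (dehom F) (dehom G)) (hq0 : q ≠ 0)
    (hq1 : ‖q‖ < 1) (hm : 2 ≤ m) (heven : Even m) :
    Rmin K (m ^ 2) F G = ((m : ℝ) ^ 2 * ((m : ℝ) ^ 2 - 1) / 6 -
      ((m : ℝ) ^ 5 + (m : ℝ) ^ 4 - 2 * (m : ℝ) ^ 3) / (8 * ((m : ℝ) + 1))) * ordv K q := by
  obtain ⟨i, hi⟩ := heven
  rw [← two_mul] at hi
  subst hi
  rcases Nat.even_or_odd' i with ⟨n, rfl | rfl⟩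
  · have hn : (1 : ℝ) ≤ n := by
      have : 1 ≤ n := by omega
      exact_mod_cast this
    rw [H.Rmin_eq hF hG hq0 hq1 hm (t := n / (4 * n + 1)) (k := 2 * n - 1) (by omega)]
    · rw [show (2 * n - 1) / 2 = n - 1 by omega]
      push_cast [show 1 ≤ n by omega]
      field_simp
      ring
    · rw [gridPt, div_lt_iff₀ (by positivity)]
      push_cast [show 1 ≤ 2 * n by omega]
      rw [div_mul_eq_mul_div, lt_div_iff₀ (by positivity)]
      nlinarith
    · rw [gridPt, lt_div_iff₀ (by positivity)]
      push_cast [show 1 ≤ 2 * n by omega]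
      rw [div_mul_eq_mul_div, div_lt_iff₀ (by positivity)]
      nlinarith
    · refine norm_coe_unitAddCircle_eq n ?_ ?_
      · push_cast
        have : 2 * (2 * (n : ℝ)) * (n / (4 * n + 1)) - n = -(n / (4 * n + 1)) := by
          field_simp
          ring
        rw [this, abs_neg, abs_of_nonneg (by positivity)]
      · push_cast
        rw [div_le_div_iff₀ (by positivity) (by positivity)]
        linarith
    · left
      rw [show (2 * n - 1 + 1) / 2 = n by omega]
      push_cast
      nlinarith
    · right
      rw [show (2 * n - 1) / 2 = n - 1 by omega]
      push_cast [show 1 ≤ n by omega]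
      nlinarith
  · rw [H.Rmin_eq hF hG hq0 hq1 hm (t := (n + 1) / (4 * n + 3)) (k := 2 * n + 1) (by omega)]
    · rw [show (2 * n + 1) / 2 = n by omega]
      push_cast
      field_simp
      ring
    · rw [gridPt, div_lt_iff₀ (by positivity)]
      push_cast
      rw [div_mul_eq_mul_div, lt_div_iff₀ (by positivity)]
      nlinarith
    · rw [gridPt, lt_div_iff₀ (by positivity)]
      push_cast
      rw [div_mul_eq_mul_div, div_lt_iff₀ (by positivity)]
      nlinarith
    · refine norm_coe_unitAddCircle_eq (n + 1) ?_ ?_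
      · push_cast
        have : 2 * (2 * (n : ℝ) + 1) * ((n + 1) / (4 * n + 3)) - (n + 1) =
            -((n + 1) / (4 * n + 3)) := by
          field_simp
          ring
        rw [this, abs_neg, abs_of_nonneg (by positivity)]
      · push_cast
        rw [div_le_div_iff₀ (by positivity) (by positivity)]
        linarith
    · left
      rw [show (2 * n + 1 + 1) / 2 = n + 1 by omega]
      push_cast
      nlinarith
    · right
      rw [show (2 * n + 1) / 2 = n by omega]
      push_cast
      nlinarith

lemma tateRelation_of_semiconj [CompleteSpace K] (hq0 : q ≠ 0) (hq1 : ‖q‖ < 1) (hm : 2 ≤ m)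
    {F G : MvPolynomial (Fin 2) K}
    (hsemi : ∀ w : K, w ≠ 0 → (∀ n : ℤ, w ≠ q ^ n) → (∀ n : ℤ, w ^ m ≠ q ^ n) →
      MvPolynomial.eval ![xTate K q w, 1] G ≠ 0 ∧
      MvPolynomial.eval ![xTate K q w, 1] F =
        xTate K q (w ^ m) * MvPolynomial.eval ![xTate K q w, 1] G) :
    TateRelation q m (dehom F) (dehom G) := by
  intro t h0 h1 hn
  have hq := norm_pos_iff.mpr hq0
  have hm0 : (0 : ℝ) < m := by positivity
  obtain ⟨w, hw0, hw⟩ := exists_norm_eq_rpow hq0 t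
  have hwm : ‖w ^ m‖ = ‖q‖ ^ ((m : ℝ) * t) := by
    rw [norm_pow, hw, ← Real.rpow_natCast, ← Real.rpow_mul hq.le, mul_comm]
  have hpow : ∀ {y : K} {u : ℝ} (n : ℤ), ‖y‖ = ‖q‖ ^ u → y = q ^ n → u = n := by
    intro y u n hy he
    rw [he, norm_zpow, ← Real.rpow_intCast] at hy
    exact ((Real.rpow_right_inj hq hq1.ne).mp hy).symm
  have ht : ∀ n : ℤ, 2 * (t : ℝ) ≠ n := by
    intro n hn
    have h2 : (0 : ℝ) < n := by linarith
    have h3 : (n : ℝ) < 1 := by linarith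
    have h4 : 0 < n := by exact_mod_cast h2
    have h5 : n < 1 := by exact_mod_cast h3
    omega
  obtain ⟨hG, hF⟩ := hsemi w hw0
    (fun n he => ht (2 * n) (by rw [hpow n hw he]; push_cast; ring))
    (fun n he => hn (2 * n) (by rw [hpow n hwm he]; push_cast; ring))
  refine ⟨xTate K q w, ?_, ?_, ?_⟩
  · rw [norm_xTate hq0 hq1 h0 hw ht, norm_coe_unitAddCircle_of_le_half h0.le h1.le]
  · rwa [eval_dehom]
  · rw [eval_dehom, eval_dehom, hF, norm_mul, norm_xTate hq0 hq1 (by positivity) hwm hn]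

end MinimalResultant

/-- In the setting of the Lattès map `ψ_m` for the Tate curve with parameter
`q`, the minimal resultant is `R_{[ψ_m]} = (m²(m²−1)/24)·ord(q)` for `m` odd, and
`R_{[ψ_m]} = (m²(m²−1)/6 − (m⁵+m⁴−2m³)/(8(m+1)))·ord(q)` for `m` even. -/
theorem lattes_minimal_resultant {K : Type} [NontriviallyNormedField K] [IsAlgClosed K]
    [CompleteSpace K] [IsUltrametricDist K]
    (hK2 : ringChar K ≠ 2) (hK3 : ringChar K ≠ 3)
    (hk2 : ringChar (kk K) ≠ 2) (hk3 : ringChar (kk K) ≠ 3)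
    (q : K) (hq0 : q ≠ 0) (hq1 : ‖q‖ < 1) (m : ℕ) (hm : 2 ≤ m)
    (F G : MvPolynomial (Fin 2) K) (hlift : LiftPair K (m ^ 2) F G)
    (hnorm : Normalized K F G)
    (hsemi : ∀ w : K, w ≠ 0 → (∀ n : ℤ, w ≠ q ^ n) → (∀ n : ℤ, w ^ m ≠ q ^ n) →
      MvPolynomial.eval ![xTate K q w, 1] G ≠ 0 ∧
      MvPolynomial.eval ![xTate K q w, 1] F =
        xTate K q (w ^ m) * MvPolynomial.eval ![xTate K q w, 1] G) :
    (Odd m → Rmin K (m ^ 2) F G =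
        ((m : ℝ) ^ 2 * ((m : ℝ) ^ 2 - 1) / 24) * ordv K q) ∧
    (Even m → Rmin K (m ^ 2) F G =
        ((m : ℝ) ^ 2 * ((m : ℝ) ^ 2 - 1) / 6 -
          ((m : ℝ) ^ 5 + (m : ℝ) ^ 4 - 2 * (m : ℝ) ^ 3) / (8 * ((m : ℝ) + 1))) * ordv K q) := by
  have H := tateRelation_of_semiconj hq0 hq1 hm hsemi
  exact ⟨H.Rmin_of_odd hlift.1 hlift.2.1 hq0 hq1 hm, H.Rmin_of_even hlift.1 hlift.2.1 hq0 hq1 hm⟩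

end
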